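/- arXiv:2301.08338 — 2 statements merged into one kernel-verified Lean document; each statement's English description precedes it below -/
import Mathlib

section
/- Assume Ψ satisfies the SOSC and that the similarity dimension s of E is not an integer. Then there are uncountably many similarity-equivalence classes of proper restricted balls of E: there exists an uncountable family of proper restricted balls B(x, d) ∩ E (with x ∈ E) such that for any two distinct members B ∩ E and B′ ∩ E of the family there is no surjective similarity f of ℝⁿ with f(B ∩ E) = B′ ∩ E. -/
open MeasureTheory Filter Topology
open scoped ENNReal

noncomputable section

/-- `f` is a similarity of ratio `r`. -/
def IsSimilarityRatio {X : Type*} [MetricSpace X] (f : X → X) (r : ℝ) : Prop :=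
  ∀ x y, dist (f x) (f y) = r * dist x y

/-- The spherical diameter of a subset `C` of `A`:
`|C|_Sph = inf {2d : C = B(x, d) ∩ A for some x ∈ C, d > 0}`. -/
def sphDiam {n : ℕ} (A C : Set (EuclideanSpace ℝ (Fin n))) : ℝ :=
  sInf {t : ℝ | ∃ x ∈ C, ∃ d : ℝ, 0 < d ∧ C = Metric.closedBall x d ∩ A ∧ t = 2 * d}

section Similarities

variable {X : Type*} [NormedAddCommGroup X] [InnerProductSpace ℝ X] [FiniteDimensional ℝ X]

lemma IsSimilarityRatio.exists_linearIsometryEquiv {g : X → X} {ρ : ℝ} (hρ : 0 < ρ)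
    (h : IsSimilarityRatio g ρ) :
    ∃ Q : X ≃ₗᵢ[ℝ] X, ∀ p q, g q = g p + ρ • Q (q - p) := by
  have hi : Isometry (fun x => ρ⁻¹ • g x) := by
    refine Isometry.of_dist_eq fun x y => ?_
    rw [dist_smul₀, h x y, Real.norm_of_nonneg (inv_nonneg.2 hρ.le)]
    field_simp
  set a := hi.affineIsometryOfStrictConvexSpace
  refine ⟨a.linearIsometry.toLinearIsometryEquiv rfl, fun p q => ?_⟩
  have h1 : a.linearIsometry (q - p) = ρ⁻¹ • g q - ρ⁻¹ • g p := by
    have := a.map_vsub q p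
    simpa [a] using this
  rw [LinearIsometry.coe_toLinearIsometryEquiv, h1, smul_sub, smul_inv_smul₀ hρ.ne',
    smul_inv_smul₀ hρ.ne']
  abel

lemma IsSimilarityRatio.comp {Y : Type*} [MetricSpace Y] {g h : Y → Y} {ρ σ : ℝ}
    (hg : IsSimilarityRatio g ρ) (hh : IsSimilarityRatio h σ) :
    IsSimilarityRatio (g ∘ h) (ρ * σ) := fun x y => by
  simp only [Function.comp]; rw [hg, hh, mul_assoc]

lemma IsSimilarityRatio.injective {Y : Type*} [MetricSpace Y] {g : Y → Y} {ρ : ℝ}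
    (hρ : 0 < ρ) (hg : IsSimilarityRatio g ρ) : Function.Injective g := fun x y hxy => by
  have := hg x y
  rw [hxy, dist_self] at this
  exact dist_eq_zero.1 ((mul_eq_zero.1 this.symm).resolve_left hρ.ne')

lemma IsSimilarityRatio.surjective {g : X → X} {ρ : ℝ} (hρ : 0 < ρ)
    (hg : IsSimilarityRatio g ρ) : Function.Surjective g := fun y => by
  obtain ⟨Q, hQ⟩ := hg.exists_linearIsometryEquiv hρ
  refine ⟨Q.symm (ρ⁻¹ • (y - g 0)), ?_⟩
  rw [hQ 0]
  simp [smul_inv_smul₀ hρ.ne']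

lemma IsSimilarityRatio.continuous {Y : Type*} [MetricSpace Y] {g : Y → Y} {ρ : ℝ}
    (hρ : 0 < ρ) (hg : IsSimilarityRatio g ρ) : Continuous g :=
  (LipschitzWith.of_dist_le_mul (K := ⟨ρ, hρ.le⟩) fun x y => (hg x y).le).continuous

lemma IsSimilarityRatio.isOpenMap {g : X → X} {ρ : ℝ} (hρ : 0 < ρ)
    (hg : IsSimilarityRatio g ρ) : IsOpenMap g := by
  intro U hU
  rw [Metric.isOpen_iff] at hU ⊢
  rintro _ ⟨x, hx, rfl⟩
  obtain ⟨ε, hε, h⟩ := hU x hx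
  refine ⟨ρ * ε, by positivity, fun y hy => ?_⟩
  obtain ⟨z, rfl⟩ := hg.surjective hρ y
  refine ⟨z, h ?_, rfl⟩
  rw [Metric.mem_ball, hg] at hy
  exact lt_of_mul_lt_mul_left hy hρ.le

lemma LinearIsometryEquiv.mul_apply_eq {Y : Type*} [NormedAddCommGroup Y] [InnerProductSpace ℝ Y]
    (P Q : Y ≃ₗᵢ[ℝ] Y) (v : Y) : (P * Q) v = P (Q v) := rfl

/-- Powers of a linear isometry of a finite-dimensional space return close to the identity
at every given vector. -/
lemma LinearIsometryEquiv.exists_pow_apply_dist_lt (Q : X ≃ₗᵢ[ℝ] X) (v : X) {ε : ℝ}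
    (hε : 0 < ε) (N : ℕ) : ∃ j, N ≤ j ∧ dist ((Q ^ j) v) v < ε := by
  have hb : ∀ j : ℕ, (Q ^ j) v ∈ Metric.closedBall (0 : X) ‖v‖ := fun j => by simp
  obtain ⟨a, -, ψ, hψ, ha⟩ := (isCompact_closedBall (0 : X) ‖v‖).tendsto_subseq hb
  obtain ⟨M, hM⟩ := Metric.cauchySeq_iff.1 ha.cauchySeq ε hε
  refine ⟨ψ (M + ψ M + N) - ψ M, ?_, ?_⟩
  · have := hψ.id_le (M + ψ M + N)
    simp only [id] at this
    omega
  · have h1 := hM (M + ψ M + N) (by omega) M le_rfl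
    have h2 : ψ M ≤ ψ (M + ψ M + N) := hψ.monotone (by omega)
    have h3 : (Q ^ ψ (M + ψ M + N)) v
        = (Q ^ ψ M) ((Q ^ (ψ (M + ψ M + N) - ψ M)) v) := by
      rw [← LinearIsometryEquiv.mul_apply_eq, ← pow_add]
      congr 2
      omega
    simp only [Function.comp] at h1
    rwa [h3, LinearIsometryEquiv.dist_map] at h1

end Similarities

section Copies

variable {X : Type*} [MetricSpace X]

/-- A similarity `g` which maps `E` into `E`, maps the open set `O` into itself, and for which
`E` has no points in `g '' O` other than those of `g '' (E ∩ O)`. -/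
structure SelfCopy (E O : Set X) (g : X → X) (ρ : ℝ) : Prop where
  pos : 0 < ρ
  sim : IsSimilarityRatio g ρ
  mapsTo : ∀ q ∈ E, g q ∈ E
  mapsO : ∀ q ∈ O, g q ∈ O
  reflects : ∀ q ∈ O, g q ∈ E → q ∈ E

lemma SelfCopy.comp {E O : Set X} {g h : X → X} {ρ σ : ℝ} (hg : SelfCopy E O g ρ)
    (hh : SelfCopy E O h σ) : SelfCopy E O (g ∘ h) (ρ * σ) where
  pos := mul_pos hg.pos hh.pos
  sim := hg.sim.comp hh.sim
  mapsTo _ hq := hg.mapsTo _ (hh.mapsTo _ hq)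
  mapsO _ hq := hg.mapsO _ (hh.mapsO _ hq)
  reflects _ hq h := hh.reflects _ hq (hg.reflects _ (hh.mapsO _ hq) h)

lemma SelfCopy.iterate {E O : Set X} {g : X → X} {ρ : ℝ} (hg : SelfCopy E O g ρ) (j : ℕ) :
    SelfCopy E O g^[j] (ρ ^ j) := by
  induction j with
  | zero => exact ⟨by simp, fun x y => by simp, by simp, by simp, by simp⟩
  | succ j ih => rw [Function.iterate_succ, pow_succ]; exact ih.comp hg

/-- The local geometry of a self-similar set around a point `ξ` fixed by a contracting copy
map: copies of `ξ` are dense in the set. -/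
structure CopyStructure (E O : Set X) (ξ : X) (φ : X → X) (r : ℝ) : Prop where
  compact : IsCompact E
  isOpen : IsOpen O
  mem : ξ ∈ E
  memO : ξ ∈ O
  copy : SelfCopy E O φ r
  lt_one : r < 1
  fixed : φ ξ = ξ
  dense : ∀ x ∈ E, ∀ ε > 0, ∃ g ρ, SelfCopy E O g ρ ∧ dist (g ξ) x < ε
  small : ∀ x ∈ E, ∀ ε > 0, ∃ g ρ, SelfCopy E O g ρ ∧ g '' E ⊆ Metric.ball x ε
  nontrivial : ∃ q ∈ E, q ≠ ξ

variable {E O : Set X} {ξ : X} {φ : X → X} {r : ℝ}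

lemma CopyStructure.iterate_fixed (H : CopyStructure E O ξ φ r) (j : ℕ) : φ^[j] ξ = ξ :=
  Function.iterate_fixed H.fixed j

end Copies

section CopiesInSpace

variable {X : Type*} [NormedAddCommGroup X] [InnerProductSpace ℝ X]
  {E O : Set X} {ξ : X} {φ : X → X} {r : ℝ}

lemma iterate_eq_of_linear {Q : X ≃ₗᵢ[ℝ] X} (hQ : ∀ p q, φ q = φ p + r • Q (q - p))
    (j : ℕ) (p q : X) : φ^[j] q = φ^[j] p + r ^ j • (Q ^ j) (q - p) := by
  induction j with
  | zero => simp
  | succ j ih =>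
    rw [Function.iterate_succ_apply', Function.iterate_succ_apply', hQ (φ^[j] p) (φ^[j] q), ih]
    simp only [add_sub_cancel_left, map_smul, smul_smul, pow_succ' Q, pow_succ' r,
      LinearIsometryEquiv.mul_apply_eq]

variable [FiniteDimensional ℝ X]

/-- No relatively open piece of `E` lies on a sphere. -/
lemma CopyStructure.not_sphere (H : CopyStructure E O ξ φ r) {c : X} {R τ : ℝ} (hτ : 0 < τ)
    (h : ∀ q ∈ E, dist q ξ < τ → dist q c = R) : False := by
  obtain ⟨q, hq, hne⟩ := H.nontrivial
  obtain ⟨Q, hQ⟩ := H.copy.sim.exists_linearIsometryEquiv H.copy.pos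
  have hr := H.copy.pos
  set e := q - ξ
  have he : 0 < ‖e‖ := norm_pos_iff.2 (sub_ne_zero.2 hne)
  have hit : ∀ j, φ^[j] q = ξ + r ^ j • (Q ^ j) e := fun j => by
    rw [iterate_eq_of_linear hQ j ξ q, H.iterate_fixed]
  have hξ : ‖ξ - c‖ = R := by rw [← dist_eq_norm]; exact h ξ H.mem (by simpa)
  obtain ⟨N, hN⟩ : ∃ N : ℕ, r ^ N * ‖e‖ < τ := by
    obtain ⟨N, hN⟩ := exists_pow_lt_of_lt_one (div_pos hτ he) H.lt_one
    exact ⟨N, by rwa [lt_div_iff₀ he] at hN⟩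
  have key : ∀ j, N ≤ j → 2 * inner ℝ (ξ - c) ((Q ^ j) e) + r ^ j * ‖e‖ ^ 2 = 0 := by
    intro j hj
    have hle : r ^ j ≤ r ^ N := pow_le_pow_of_le_one hr.le H.lt_one.le hj
    have h1 : dist (φ^[j] q) ξ < τ := by
      rw [hit, dist_eq_norm, add_sub_cancel_left, norm_smul, LinearIsometryEquiv.norm_map,
        Real.norm_of_nonneg (by positivity)]
      nlinarith
    have h2 := h _ ((H.copy.iterate j).mapsTo q hq) h1
    rw [hit, dist_eq_norm, add_sub_right_comm] at h2
    have h3 := norm_add_sq_real (ξ - c) (r ^ j • (Q ^ j) e)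
    rw [h2, hξ, inner_smul_right, norm_smul, LinearIsometryEquiv.norm_map,
      Real.norm_of_nonneg (by positivity)] at h3
    have h4 : 0 < r ^ j := by positivity
    have : r ^ j * (2 * inner ℝ (ξ - c) ((Q ^ j) e) + r ^ j * ‖e‖ ^ 2) = 0 := by linarith
    exact (mul_eq_zero.1 this).resolve_left h4.ne'
  have h0 := key N le_rfl
  have hpos : 0 < r ^ N * ‖e‖ ^ 2 := by positivity
  obtain ⟨M, hM⟩ : ∃ M : ℕ, r ^ M < 1 / 2 := exists_pow_lt_of_lt_one (by norm_num) H.lt_one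
  have hRn : 0 ≤ R := hξ ▸ norm_nonneg _
  set η := r ^ N * ‖e‖ ^ 2 / (4 * (R + 1)) with hη
  obtain ⟨j, hj, hjd⟩ := Q.exists_pow_apply_dist_lt ((Q ^ N) e) (ε := η)
    (by positivity) M
  have h1 := key (j + N) (by omega)
  rw [pow_add, LinearIsometryEquiv.mul_apply_eq] at h1
  rw [dist_eq_norm] at hjd
  have h2 : |inner ℝ (ξ - c) ((Q ^ j) ((Q ^ N) e) - (Q ^ N) e)| ≤ R * η :=
    (abs_real_inner_le_norm _ _).trans (by rw [hξ]; gcongr)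
  rw [inner_sub_right] at h2
  have h3 : r ^ (j + N) ≤ r ^ N * (1 / 2) := by
    rw [pow_add, mul_comm]
    gcongr
    exact (pow_le_pow_of_le_one hr.le H.lt_one.le hj).trans hM.le
  have h4 : R * η * 4 ≤ r ^ N * ‖e‖ ^ 2 * (R / (R + 1)) := by
    rw [hη]; apply le_of_eq; field_simp
  have h5 : R / (R + 1) < 1 := by rw [div_lt_one (by linarith)]; linarith
  have h6 : r ^ (j + N) * ‖e‖ ^ 2 ≤ r ^ N * (1 / 2) * ‖e‖ ^ 2 := by gcongr
  have h7 := abs_le.1 h2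
  nlinarith

end CopiesInSpace

section Translations

variable {X : Type*} [NormedAddCommGroup X] [InnerProductSpace ℝ X]

/-- The vectors along which `E` is locally invariant under translations near `y`. -/
def translationSpace (E : Set X) (y : X) : Submodule ℝ X where
  carrier := {v | ∃ τ > 0, ∀ q ∈ E, dist q y < τ → ∀ t : ℝ, |t| < τ → q + t • v ∈ E}
  zero_mem' := ⟨1, one_pos, fun q hq _ t _ => by simpa⟩
  add_mem' := by
    rintro v w ⟨τ, hτ, hv⟩ ⟨σ, hσ, hw⟩
    have hv0 : 0 < ‖v‖ + 1 := by positivity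
    refine ⟨min τ (σ / (‖v‖ + 2)), by positivity, fun q hq hqy t ht => ?_⟩
    obtain ⟨h1, h2⟩ := lt_min_iff.1 hqy
    obtain ⟨h3, h4⟩ := lt_min_iff.1 ht
    rw [lt_div_iff₀ (by positivity)] at h2 h4
    rw [smul_add, ← add_assoc]
    refine hw _ (hv q hq h1 t h3) ?_ t ?_
    · calc dist (q + t • v) y ≤ dist (q + t • v) q + dist q y := dist_triangle _ _ _
        _ = |t| * ‖v‖ + dist q y := by simp [norm_smul]
        _ < σ := by nlinarith [norm_nonneg v, abs_nonneg t, dist_nonneg (x := q) (y := y)]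
    · nlinarith [norm_nonneg v, abs_nonneg t]
  smul_mem' := by
    rintro c v ⟨τ, hτ, hv⟩
    refine ⟨min τ (τ / (|c| + 1)), by positivity, fun q hq hqy t ht => ?_⟩
    obtain ⟨h3, h4⟩ := lt_min_iff.1 ht
    rw [lt_div_iff₀ (by positivity)] at h4
    rw [smul_smul]
    refine hv q hq (hqy.trans_le (min_le_left _ _)) _ ?_
    rw [abs_mul]
    nlinarith [abs_nonneg t]

lemma mem_translationSpace {E : Set X} {y v : X} : v ∈ translationSpace E y ↔
    ∃ τ > 0, ∀ q ∈ E, dist q y < τ → ∀ t : ℝ, |t| < τ → q + t • v ∈ E := Iff.rfl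

/-- The translation invariance is uniform over the whole translation space. -/
lemma exists_forall_add_mem [FiniteDimensional ℝ X] (E : Set X) (y : X) :
    ∃ τ > 0, ∀ q ∈ E, dist q y < τ → ∀ v ∈ translationSpace E y, ‖v‖ < τ → q + v ∈ E := by
  let b := stdOrthonormalBasis ℝ (translationSpace E y)
  have hb : ∀ i, ‖(b i : X)‖ = 1 := fun i => by
    rw [Submodule.norm_coe]; exact b.orthonormal.1 i
  have key : ∀ s : Finset (Fin (Module.finrank ℝ (translationSpace E y))), ∃ τ > 0,
      ∀ q ∈ E, dist q y < τ → ∀ c : Fin (Module.finrank ℝ (translationSpace E y)) → ℝ,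
      (∀ i, |c i| < τ) → q + ∑ i ∈ s, c i • (b i : X) ∈ E := by
    intro s
    induction s using Finset.induction_on with
    | empty => exact ⟨1, one_pos, fun q hq _ c _ => by simpa⟩
    | insert a s ha ih =>
      obtain ⟨τ, hτ, h⟩ := ih
      obtain ⟨σ, hσ, hσ'⟩ := mem_translationSpace.1 (b a).2
      refine ⟨min (τ / 2) σ, by positivity, fun q hq hqy c hc => ?_⟩
      rw [Finset.sum_insert ha, ← add_assoc]
      have h1 := fun i => (lt_min_iff.1 (hc i)).1
      have h2 := (lt_min_iff.1 (hc a)).2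
      obtain ⟨h3, h4⟩ := lt_min_iff.1 hqy
      refine h _ (hσ' q hq h4 _ h2) ?_ c fun i => (h1 i).trans (by linarith)
      calc dist (q + c a • (b a : X)) y
          ≤ dist (q + c a • (b a : X)) q + dist q y := dist_triangle _ _ _
        _ = |c a| + dist q y := by simp [norm_smul, hb]
        _ < τ := by linarith [h1 a]
  obtain ⟨τ, hτ, h⟩ := key Finset.univ
  refine ⟨τ, hτ, fun q hq hqy v hv hvτ => ?_⟩
  have h1 := h q hq hqy (fun i => b.repr ⟨v, hv⟩ i) fun i => by
    refine lt_of_le_of_lt ?_ hvτ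
    have := PiLp.norm_apply_le (b.repr ⟨v, hv⟩) i
    rw [b.repr.norm_map] at this
    simpa using this
  have h2 : v = ∑ i, b.repr ⟨v, hv⟩ i • (b i : X) := by
    have := congrArg (Subtype.val) (b.sum_repr ⟨v, hv⟩)
    simpa using this.symm
  rwa [← h2] at h1

/-- Euler polygons along small steps that stay in a closed set. -/
lemma exists_mem_near_add_smul {E : Set X} {p u : X} {ρ η : ℝ} {N : ℕ → ℝ}
    (hN0 : ∀ᶠ k in atTop, 0 < N k) (hN : Tendsto N atTop (𝓝 0)) {w : ℕ → X → X}
    (hw : ∀ᶠ k in atTop, ∀ q ∈ E, dist q p < ρ → ‖w k q - u‖ ≤ η ∧ q + N k • w k q ∈ E)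
    {q : X} (hq : q ∈ E) {T : ℝ} (hT : 0 ≤ T) (hη : 0 ≤ η)
    (hqT : dist q p + T * (‖u‖ + η) < ρ) {ε : ℝ} (hε : 0 < ε) :
    ∃ z ∈ E, ‖z - (q + T • u)‖ ≤ T * η + ε := by
  have hsmall : ∀ᶠ k in atTop, N k * ‖u‖ < ε := by
    have : Tendsto (fun k => N k * ‖u‖) atTop (𝓝 (0 * ‖u‖)) := hN.mul_const _
    rw [zero_mul] at this
    exact this.eventually_lt_const hε
  obtain ⟨k, hk0, hk, hkε⟩ := (hN0.and (hw.and hsmall)).exists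
  set n := ⌊T / N k⌋₊ with hn
  have hnT : n * N k ≤ T := by
    rw [← le_div_iff₀ hk0]; exact Nat.floor_le (by positivity)
  have hTn : T < n * N k + N k := by
    have := Nat.lt_floor_add_one (T / N k)
    rw [div_lt_iff₀ hk0] at this
    linarith
  have key : ∀ i : ℕ, i ≤ n → ∃ z ∈ E, ‖z - (q + (i * N k) • u)‖ ≤ i * N k * η := by
    intro i
    induction i with
    | zero => exact fun _ => ⟨q, hq, by simp⟩
    | succ i ih =>
      intro hi
      obtain ⟨z, hz, hzd⟩ := ih (by omega)
      have hiT : i * N k ≤ T := by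
        refine le_trans ?_ hnT
        have : (i : ℝ) ≤ n := by exact_mod_cast (by omega : i ≤ n)
        gcongr
      have hzp : dist z p < ρ := by
        have h1 : ‖z - q‖ ≤ i * N k * η + i * N k * ‖u‖ := by
          have : z - q = (z - (q + (i * N k) • u)) + (i * N k) • u := by abel
          rw [this]
          refine (norm_add_le _ _).trans ?_
          rw [norm_smul, Real.norm_of_nonneg (by positivity)]
          gcongr
        have h2 := dist_triangle z q p
        rw [dist_eq_norm z q] at h2
        nlinarith [norm_nonneg u]
      obtain ⟨h1, h2⟩ := hk z hz hzp
      refine ⟨_, h2, ?_⟩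
      have : z + N k • w k z - (q + ((i + 1 : ℕ) * N k) • u)
          = (z - (q + (i * N k) • u)) + N k • (w k z - u) := by
        push_cast
        module
      rw [this]
      refine (norm_add_le _ _).trans ?_
      rw [norm_smul, Real.norm_of_nonneg hk0.le]
      push_cast
      nlinarith
  obtain ⟨z, hz, hzd⟩ := key n le_rfl
  refine ⟨z, hz, ?_⟩
  have : z - (q + T • u) = (z - (q + (n * N k) • u)) - (T - n * N k) • u := by module
  rw [this]
  refine (norm_sub_le _ _).trans ?_
  rw [norm_smul, Real.norm_of_nonneg (by linarith)]
  nlinarith [norm_nonneg u]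

end Translations

section Blowup

variable {X : Type*} [NormedAddCommGroup X] [InnerProductSpace ℝ X]
  {E O : Set X} {ξ : X} {φ : X → X} {r : ℝ}

/-- Pulling back the translation space of `E` along a copy map. -/
lemma CopyStructure.symm_mem_translationSpace (H : CopyStructure E O ξ φ r) {g : X → X} {ρ : ℝ}
    (hg : SelfCopy E O g ρ) {Q : X ≃ₗᵢ[ℝ] X} (hQ : ∀ p q, g q = g p + ρ • Q (q - p)) {v : X}
    (hv : v ∈ translationSpace E (g ξ)) : Q.symm v ∈ translationSpace E ξ := by
  obtain ⟨τ, hτ, h⟩ := hv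
  obtain ⟨δ, hδ, hO⟩ := Metric.isOpen_iff.1 H.isOpen ξ H.memO
  have hρ := hg.pos
  refine ⟨min (τ / ρ) (δ / (‖v‖ + 2)), by positivity, fun q hq hqξ t ht => ?_⟩
  obtain ⟨h1, h2⟩ := lt_min_iff.1 hqξ
  obtain ⟨h3, h4⟩ := lt_min_iff.1 ht
  rw [lt_div_iff₀ (by positivity)] at h1 h2 h3 h4
  refine hg.reflects _ (hO ?_) ?_
  · rw [Metric.mem_ball]
    calc dist (q + t • Q.symm v) ξ ≤ dist (q + t • Q.symm v) q + dist q ξ := dist_triangle _ _ _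
      _ = |t| * ‖v‖ + dist q ξ := by simp [norm_smul]
      _ < δ := by nlinarith [norm_nonneg v, abs_nonneg t, dist_nonneg (x := q) (y := ξ)]
  · have := h (g q) (hg.mapsTo q hq) (by rw [hg.sim]; linarith) (ρ * t)
      (by rw [abs_mul, abs_of_pos hρ]; linarith)
    rw [hQ q]
    simpa [smul_smul] using this

variable [FiniteDimensional ℝ X]

/-- If the closed set `E` is invariant under smaller and smaller displacements whose directions
tend to `u` near a copy of `ξ`, then `E` is locally invariant under translations along `u` by
nonnegative amounts, after pulling back to `ξ`. -/
lemma CopyStructure.add_smul_mem_of_displacements (H : CopyStructure E O ξ φ r) {g : X → X}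
    {ρ : ℝ} (hg : SelfCopy E O g ρ) {Q : X ≃ₗᵢ[ℝ] X} (hQ : ∀ p q, g q = g p + ρ • Q (q - p))
    {N : ℕ → ℝ} (hN0 : ∀ᶠ k in atTop, 0 < N k) (hN : Tendsto N atTop (𝓝 0)) {w : ℕ → X → X}
    {u : X} (hw : ∀ η > 0, ∃ ρ' > 0, ∀ᶠ k in atTop, ∀ q ∈ E, dist q (g ξ) < ρ' →
      ‖w k q - u‖ ≤ η ∧ q + N k • w k q ∈ E) :
    ∃ τ > 0, ∀ q ∈ E, dist q ξ < τ → ∀ t : ℝ, 0 ≤ t → t < τ → q + t • Q.symm u ∈ E := by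
  obtain ⟨δ, hδ, hO⟩ := Metric.isOpen_iff.1 H.isOpen ξ H.memO
  obtain ⟨P, hP⟩ := H.copy.sim.exists_linearIsometryEquiv H.copy.pos
  have hr := H.copy.pos
  have hρ := hg.pos
  set τ := min 1 (δ / (‖u‖ + 4)) with hτdef
  have hτ : 0 < τ := by positivity
  refine ⟨τ, hτ, fun q hq hqξ t ht0 ht => ?_⟩
  rw [← H.compact.isClosed.closure_eq, Metric.mem_closure_iff]
  intro ε' hε'
  set ε := min 1 (min τ (ε' / 4)) with hεdef
  have hε : 0 < ε := by positivity
  have hε1 : ε ≤ 1 := min_le_left _ _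
  have hετ : ε ≤ τ := (min_le_right _ _).trans (min_le_left _ _)
  have hεε : ε ≤ ε' / 4 := (min_le_right _ _).trans (min_le_right _ _)
  have hτ1 : τ ≤ 1 := min_le_left _ _
  have hτδ : τ * (‖u‖ + 4) ≤ δ := by
    rw [← le_div_iff₀ (by positivity)]; exact min_le_right _ _
  obtain ⟨ρ', hρ', hev⟩ := hw ε hε
  obtain ⟨M, hM⟩ : ∃ M : ℕ, r ^ M * (ρ * (‖u‖ + 2)) < ρ' := by
    obtain ⟨M, hM⟩ := exists_pow_lt_of_lt_one
      (show 0 < ρ' / (ρ * (‖u‖ + 2)) by positivity) H.lt_one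
    exact ⟨M, by rwa [lt_div_iff₀ (by positivity)] at hM⟩
  obtain ⟨j, hjM, hj⟩ := P.exists_pow_apply_dist_lt (Q.symm u) hε M
  have hψ := hg.comp (H.copy.iterate j)
  set σ := ρ * r ^ j with hσdef
  have hσ : 0 < σ := hψ.pos
  have hψξ : (g ∘ φ^[j]) ξ = g ξ := by simp [H.iterate_fixed]
  have hψlin : ∀ p z, (g ∘ φ^[j]) z = (g ∘ φ^[j]) p + σ • Q ((P ^ j) (z - p)) := fun p z => by
    simp only [Function.comp]
    rw [hQ (φ^[j] p), iterate_eq_of_linear hP j p z, add_sub_cancel_left, map_smul, smul_smul]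
  have hσM : σ * (‖u‖ + 2) < ρ' := by
    have : r ^ j ≤ r ^ M := pow_le_pow_of_le_one hr.le H.lt_one.le hjM
    refine lt_of_le_of_lt ?_ hM
    have h0 : 0 ≤ ρ * (‖u‖ + 2) := by positivity
    nlinarith
  have hdist : dist ((g ∘ φ^[j]) q) (g ξ) + (σ * t) * (‖u‖ + ε) < ρ' := by
    rw [← hψξ, hψ.sim]
    refine lt_of_le_of_lt ?_ hσM
    have h1 : t * (‖u‖ + ε) ≤ 1 * (‖u‖ + 1) := by
      gcongr
      linarith
    have h2 : dist q ξ ≤ 1 := by linarith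
    nlinarith
  obtain ⟨z, hz, hzd⟩ := exists_mem_near_add_smul hN0 hN hev (hψ.mapsTo q hq)
    (T := σ * t) (by positivity) hε.le hdist (ε := σ * ε) (by positivity)
  obtain ⟨q', rfl⟩ := hψ.sim.surjective hψ.pos z
  have hq'1 : ‖q' - q - t • (P ^ j).symm (Q.symm u)‖ ≤ t * ε + ε := by
    have h1 : (g ∘ φ^[j]) q' - ((g ∘ φ^[j]) q + (σ * t) • u)
        = σ • Q ((P ^ j) (q' - q - t • (P ^ j).symm (Q.symm u))) := by
      rw [hψlin q q']
      simp only [map_sub, map_smul, LinearIsometryEquiv.apply_symm_apply, mul_smul, smul_sub]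
      abel
    rw [h1, norm_smul, LinearIsometryEquiv.norm_map, LinearIsometryEquiv.norm_map,
      Real.norm_of_nonneg hσ.le] at hzd
    have : σ * ‖q' - q - t • (P ^ j).symm (Q.symm u)‖ ≤ σ * (t * ε + ε) := by linarith
    exact le_of_mul_le_mul_left this hσ
  have hq'2 : ‖(P ^ j).symm (Q.symm u) - Q.symm u‖ ≤ ε := by
    rw [← (P ^ j).norm_map, map_sub, LinearIsometryEquiv.apply_symm_apply, norm_sub_rev,
      ← dist_eq_norm]
    exact hj.le
  have hd : ‖q' - (q + t • Q.symm u)‖ ≤ 3 * ε := by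
    have : q' - (q + t • Q.symm u) = (q' - q - t • (P ^ j).symm (Q.symm u))
        + t • ((P ^ j).symm (Q.symm u) - Q.symm u) := by
      module
    rw [this]
    refine (norm_add_le _ _).trans ?_
    rw [norm_smul, Real.norm_of_nonneg ht0]
    nlinarith [norm_nonneg ((P ^ j).symm (Q.symm u) - Q.symm u)]
  refine ⟨q', hψ.reflects q' (hO ?_) hz, ?_⟩
  · rw [Metric.mem_ball]
    have h1 : ‖q' - ξ‖ ≤ 3 * ε + t * ‖u‖ + ‖q - ξ‖ := by
      have : q' - ξ = (q' - (q + t • Q.symm u)) + t • Q.symm u + (q - ξ) := by abel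
      rw [this]
      refine (norm_add₃_le).trans ?_
      rw [norm_smul, Real.norm_of_nonneg ht0, LinearIsometryEquiv.norm_map]
      gcongr
    rw [dist_eq_norm] at hqξ ⊢
    nlinarith [norm_nonneg u]
  · rw [dist_comm, dist_eq_norm]
    linarith

/-- Two-sided version of the previous statement. -/
lemma CopyStructure.symm_mem_of_displacements (H : CopyStructure E O ξ φ r) {g : X → X}
    {ρ : ℝ} (hg : SelfCopy E O g ρ) {Q : X ≃ₗᵢ[ℝ] X} (hQ : ∀ p q, g q = g p + ρ • Q (q - p))
    {N : ℕ → ℝ} (hN0 : ∀ᶠ k in atTop, 0 < N k) (hN : Tendsto N atTop (𝓝 0)) {w w' : ℕ → X → X}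
    {u : X} (hw : ∀ η > 0, ∃ ρ' > 0, ∀ᶠ k in atTop, ∀ q ∈ E, dist q (g ξ) < ρ' →
      ‖w k q - u‖ ≤ η ∧ q + N k • w k q ∈ E)
    (hw' : ∀ η > 0, ∃ ρ' > 0, ∀ᶠ k in atTop, ∀ q ∈ E, dist q (g ξ) < ρ' →
      ‖w' k q - -u‖ ≤ η ∧ q + N k • w' k q ∈ E) :
    Q.symm u ∈ translationSpace E ξ := by
  obtain ⟨τ, hτ, h⟩ := H.add_smul_mem_of_displacements hg hQ hN0 hN hw
  obtain ⟨σ, hσ, h'⟩ := H.add_smul_mem_of_displacements hg hQ hN0 hN hw'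
  refine ⟨min τ σ, by positivity, fun q hq hqξ t ht => ?_⟩
  obtain ⟨h1, h2⟩ := lt_min_iff.1 hqξ
  obtain ⟨h3, h4⟩ := lt_min_iff.1 ht
  rcases le_total 0 t with h0 | h0
  · exact h q hq h1 t h0 (by rwa [abs_of_nonneg h0] at h3)
  · have := h' q hq h2 (-t) (by linarith) (by rwa [abs_of_nonpos h0] at h4)
    simpa using this

end Blowup

section FlatPieces

open scoped NNReal

variable {X : Type*} [NormedAddCommGroup X] [InnerProductSpace ℝ X] [FiniteDimensional ℝ X]
  [MeasurableSpace X] [BorelSpace X]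

lemma IsSimilarityRatio.hausdorffMeasure_image {Y : Type*} [MetricSpace Y] [MeasurableSpace Y]
    [BorelSpace Y] {g : Y → Y} {ρ : ℝ} (hρ : 0 < ρ) (hg : IsSimilarityRatio g ρ) {d : ℝ}
    (hd : 0 ≤ d) (A : Set Y) : μH[d] (g '' A) = ENNReal.ofReal (ρ ^ d) * μH[d] A := by
  have h1 : LipschitzWith ⟨ρ, hρ.le⟩ g := LipschitzWith.of_dist_le_mul fun x y => (hg x y).le
  have h2 : AntilipschitzWith ⟨ρ⁻¹, by positivity⟩ g :=
    AntilipschitzWith.of_le_mul_dist fun x y => by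
      rw [hg]
      change _ ≤ ρ⁻¹ * _
      rw [inv_mul_cancel_left₀ hρ.ne']
  have e1 : ENNReal.ofNNReal ⟨ρ, hρ.le⟩ = ENNReal.ofReal ρ :=
    (ENNReal.ofReal_eq_coe_nnreal hρ.le).symm
  have e2 : ENNReal.ofNNReal ⟨ρ⁻¹, by positivity⟩ = ENNReal.ofReal ρ⁻¹ :=
    (ENNReal.ofReal_eq_coe_nnreal _).symm
  have h3 := h1.hausdorffMeasure_image_le hd A
  have h4 := h2.le_hausdorffMeasure_image hd A
  rw [e1, ENNReal.ofReal_rpow_of_pos hρ] at h3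
  rw [e2, ENNReal.ofReal_rpow_of_pos (by positivity), Real.inv_rpow hρ.le] at h4
  refine le_antisymm h3 ?_
  calc ENNReal.ofReal (ρ ^ d) * μH[d] A
      ≤ ENNReal.ofReal (ρ ^ d) * (ENNReal.ofReal (ρ ^ d)⁻¹ * μH[d] (g '' A)) := by gcongr
    _ = μH[d] (g '' A) := by
      rw [← mul_assoc, ← ENNReal.ofReal_mul (by positivity), mul_inv_cancel₀ (by positivity),
        ENNReal.ofReal_one, one_mul]

lemma hausdorffMeasure_flat_ball (W : Submodule ℝ X) (x : X) {ρ : ℝ} (hρ : 0 < ρ) :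
    0 < μH[(Module.finrank ℝ W : ℝ)] ({y | y - x ∈ W} ∩ Metric.ball x ρ) ∧
      μH[(Module.finrank ℝ W : ℝ)] ({y | y - x ∈ W} ∩ Metric.ball x ρ) < ∞ := by
  have h1 : Isometry fun w : W => x + (w : X) :=
    Isometry.of_dist_eq fun a b => by simp [Subtype.dist_eq]
  have h2 : {y | y - x ∈ W} ∩ Metric.ball x ρ
      = (fun w : W => x + (w : X)) '' Metric.ball 0 ρ := by
    ext y
    simp only [Set.mem_inter_iff, Set.mem_ofPred_eq, Metric.mem_ball, Set.mem_image]
    constructor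
    · rintro ⟨h, h'⟩
      exact ⟨⟨y - x, h⟩, by rwa [Subtype.dist_eq, Submodule.coe_zero, dist_zero_right,
        ← dist_eq_norm], by simp⟩
    · rintro ⟨w, hw, rfl⟩
      refine ⟨by simp, ?_⟩
      rw [dist_eq_norm, add_sub_cancel_left]
      simpa using hw
  rw [h2, h1.hausdorffMeasure_image (Or.inl (by positivity))]
  exact ⟨Metric.measure_ball_pos _ _ hρ, measure_ball_lt_top⟩

/-- If a relatively open piece of a self-similar set with the strong open set condition lies in
an affine subspace and is relatively open there, then the similarity dimension is the dimension
of that subspace. -/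
lemma CopyStructure.eq_finrank_of_flat {E O : Set X} {ξ : X} {φ : X → X} {t : ℝ}
    (H : CopyStructure E O ξ φ t) {m : ℕ} (hm : 0 < m) {f : Fin m → X → X}
    {r : Fin m → ℝ} (hr : ∀ i, r i ∈ Set.Ioo (0 : ℝ) 1)
    (hsim : ∀ i, IsSimilarityRatio (f i) (r i)) (hEattr : E = ⋃ i, f i '' E)
    (hOmap : ∀ i, f i '' O ⊆ O) (hOdisj : ∀ i j, i ≠ j → Disjoint (f i '' O) (f j '' O))
    {s : ℝ} (hs : ∑ i, (r i) ^ s = 1) {x : X} (hx : x ∈ E) (W : Submodule ℝ X) {ρ : ℝ}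
    (hρ : 0 < ρ) (hW : ∀ y ∈ Metric.ball x ρ, y ∈ E ↔ y - x ∈ W) :
    s = (Module.finrank ℝ W : ℝ) := by
  set k : ℝ := (Module.finrank ℝ W : ℝ) with hk
  have hk0 : 0 ≤ k := by positivity
  have hfin : μH[k] E ≠ ∞ := by
    obtain ⟨g, σ, hg, hgE⟩ := H.small x hx ρ hρ
    have h1 : g '' E ⊆ {y | y - x ∈ W} ∩ Metric.ball x ρ := by
      rintro _ ⟨q, hq, rfl⟩
      have := hgE ⟨q, hq, rfl⟩
      exact ⟨(hW _ this).1 (hg.mapsTo q hq), this⟩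
    have h2 := (measure_mono h1).trans_lt (hausdorffMeasure_flat_ball W x hρ).2
    rw [hg.sim.hausdorffMeasure_image hg.pos hk0] at h2
    intro h3
    rw [h3, ENNReal.mul_top] at h2
    · exact lt_irrefl _ h2
    · have := hg.pos
      simpa using Real.rpow_pos_of_pos this k
  have hposEO : μH[k] (E ∩ O) ≠ 0 := by
    obtain ⟨g, σ, hg, hgx⟩ := H.dense x hx ρ hρ
    have hσ := hg.pos
    obtain ⟨δ, hδ, hO⟩ := Metric.isOpen_iff.1 (hg.sim.isOpenMap hσ O H.isOpen) (g ξ)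
      ⟨ξ, H.memO, rfl⟩
    have h1 : {y | y - g ξ ∈ W} ∩ Metric.ball (g ξ) (min δ (ρ - dist (g ξ) x))
        ⊆ g '' (E ∩ O) := by
      rintro y ⟨hyW, hy⟩
      rw [Metric.mem_ball, lt_min_iff] at hy
      obtain ⟨q, hq, rfl⟩ := hO hy.1
      have hyx : g q ∈ Metric.ball x ρ := by
        rw [Metric.mem_ball]
        linarith [dist_triangle (g q) (g ξ) x]
      refine ⟨q, ⟨hg.reflects q hq ((hW _ hyx).2 ?_), hq⟩, rfl⟩
      have h2 := (hW _ hgx).1 (hg.mapsTo ξ H.mem)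
      have := W.add_mem hyW h2
      simpa using this
    have h2 := (hausdorffMeasure_flat_ball W (g ξ)
      (lt_min hδ (by linarith) : 0 < min δ (ρ - dist (g ξ) x))).1.trans_le (measure_mono h1)
    rw [hg.sim.hausdorffMeasure_image hσ hk0] at h2
    exact (pos_of_mul_pos_right h2 zero_le).ne'
  have hEO : μH[k] (E ∩ O) ≤ μH[k] E := measure_mono Set.inter_subset_left
  have hfinEO : μH[k] (E ∩ O) ≠ ∞ := ne_top_of_le_ne_top hfin hEO
  have hposE : μH[k] E ≠ 0 := fun h => hposEO (le_antisymm (hEO.trans h.le) zero_le)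
  have hscale : ∀ A : Set X, ∑ i, μH[k] (f i '' A)
      = ENNReal.ofReal (∑ i, r i ^ k) * μH[k] A := fun A => by
    rw [ENNReal.ofReal_sum_of_nonneg fun i _ => Real.rpow_nonneg (hr i).1.le _, Finset.sum_mul]
    exact Finset.sum_congr rfl fun i _ => (hsim i).hausdorffMeasure_image (hr i).1 hk0 A
  have hle : ENNReal.ofReal (∑ i, r i ^ k) ≤ 1 := by
    have h1 : ∑ i, μH[k] (f i '' (E ∩ O)) ≤ μH[k] (E ∩ O) := by
      have hmeas : ∀ i, MeasurableSet (f i '' (E ∩ O)) := fun i => by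
        rw [Set.image_inter ((hsim i).injective (hr i).1)]
        exact ((H.compact.image ((hsim i).continuous (hr i).1)).isClosed.measurableSet).inter
          ((hsim i).isOpenMap (hr i).1 O H.isOpen).measurableSet
      have hdis : Pairwise (Function.onFun Disjoint fun i => f i '' (E ∩ O)) :=
        fun i j hij => (hOdisj i j hij).mono (Set.image_mono Set.inter_subset_right)
          (Set.image_mono Set.inter_subset_right)
      rw [← tsum_fintype (L := .unconditional _), ← measure_iUnion hdis hmeas]
      refine measure_mono (Set.iUnion_subset fun i => ?_)
      rintro _ ⟨q, ⟨hqE, hqO⟩, rfl⟩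
      refine ⟨?_, hOmap i ⟨q, hqO, rfl⟩⟩
      rw [hEattr]
      exact Set.mem_iUnion.2 ⟨i, q, hqE, rfl⟩
    rw [hscale] at h1
    rw [← ENNReal.mul_le_mul_iff_left hposEO hfinEO, one_mul]
    exact h1
  have hge : 1 ≤ ENNReal.ofReal (∑ i, r i ^ k) := by
    have h1 : μH[k] E ≤ ∑ i, μH[k] (f i '' E) := by
      conv_lhs => rw [hEattr]
      exact measure_iUnion_fintype_le _ _
    rw [hscale] at h1
    rw [← ENNReal.mul_le_mul_iff_left hposE hfin, one_mul]
    exact h1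
  rw [ENNReal.ofReal_le_one] at hle
  rw [ENNReal.one_le_ofReal] at hge
  have hsum : ∑ i, r i ^ k = 1 := le_antisymm hle hge
  have hne : (Finset.univ : Finset (Fin m)).Nonempty := ⟨⟨0, hm⟩, Finset.mem_univ _⟩
  rcases lt_trichotomy s k with h | h | h
  · have := Finset.sum_lt_sum_of_nonempty hne fun i _ =>
      Real.rpow_lt_rpow_of_exponent_gt (hr i).1 (hr i).2 h
    linarith
  · exact h
  · have := Finset.sum_lt_sum_of_nonempty hne fun i _ =>
      Real.rpow_lt_rpow_of_exponent_gt (hr i).1 (hr i).2 h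
    linarith

end FlatPieces

section NearIdentity

variable {X : Type*} [NormedAddCommGroup X] [InnerProductSpace ℝ X] [FiniteDimensional ℝ X]
  {E O : Set X} {ξ : X} {φ : X → X} {r : ℝ}

/-- Displacements of `E` near a copy of `ξ` cannot have a nonzero limit direction orthogonal to
the translation space. -/
lemma CopyStructure.eq_zero_of_displacements (H : CopyStructure E O ξ φ r) {τ : ℝ} (hτ : 0 < τ)
    (hinv : ∀ q ∈ E, dist q ξ < τ → ∀ v ∈ translationSpace E ξ, ‖v‖ < τ → q + v ∈ E)
    {g : X → X} {ρ : ℝ} (hg : SelfCopy E O g ρ) (hgξ : dist (g ξ) ξ < τ)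
    {N : ℕ → ℝ} (hN0 : ∀ᶠ k in atTop, 0 < N k) (hN : Tendsto N atTop (𝓝 0)) {w w' : ℕ → X → X}
    {u : X} (hw : ∀ η > 0, ∃ ρ' > 0, ∀ᶠ k in atTop, ∀ q ∈ E, dist q (g ξ) < ρ' →
      ‖w k q - u‖ ≤ η ∧ q + N k • w k q ∈ E)
    (hw' : ∀ η > 0, ∃ ρ' > 0, ∀ᶠ k in atTop, ∀ q ∈ E, dist q (g ξ) < ρ' →
      ‖w' k q - -u‖ ≤ η ∧ q + N k • w' k q ∈ E)
    (hu : u ∈ (translationSpace E ξ)ᗮ) : u = 0 := by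
  obtain ⟨Q, hQ⟩ := hg.sim.exists_linearIsometryEquiv hg.pos
  have h1 := H.symm_mem_of_displacements hg hQ hN0 hN hw hw'
  have h2 : translationSpace E ξ ≤ translationSpace E (g ξ) := by
    intro v hv
    refine ⟨min (τ - dist (g ξ) ξ) (τ / (‖v‖ + 1)), lt_min (by linarith) (by positivity),
      fun q hq hqg t ht => ?_⟩
    obtain ⟨h3, -⟩ := lt_min_iff.1 hqg
    obtain ⟨-, h4⟩ := lt_min_iff.1 ht
    rw [lt_div_iff₀ (by positivity)] at h4
    refine hinv q hq (by linarith [dist_triangle q (g ξ) ξ]) _ (Submodule.smul_mem _ _ hv) ?_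
    rw [norm_smul, Real.norm_eq_abs]
    nlinarith [abs_nonneg t]
  have h3 : (translationSpace E ξ).map (Q.symm.toLinearEquiv : X →ₗ[ℝ] X)
      ≤ translationSpace E ξ := by
    rintro _ ⟨v, hv, rfl⟩
    exact H.symm_mem_translationSpace hg hQ (h2 hv)
  have h4 := Submodule.eq_of_le_of_finrank_eq h3 (LinearEquiv.finrank_map_eq _ _)
  rw [← h4] at h1
  obtain ⟨v, hv, hvu⟩ := h1
  have h5 : v = u := Q.symm.injective hvu
  rw [h5] at hv
  exact inner_self_eq_zero.1 (Submodule.inner_right_of_mem_orthogonal hv hu)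

/-- A self-similar set which is nowhere flat admits no sequence of local similarities of ratio
different from `1` that converges to the identity. -/
lemma CopyStructure.false_of_similarities_near_id (H : CopyStructure E O ξ φ r) {τ : ℝ}
    (hinv : ∀ q ∈ E, dist q ξ < τ → ∀ v ∈ translationSpace E ξ, ‖v‖ < τ → q + v ∈ E)
    {x₀ : X} (hx₀ : x₀ ∈ E) (hx₀τ : dist x₀ ξ < τ)
    (hnf : ∀ ρ > 0, ∃ y ∈ E, dist y x₀ < ρ ∧ y - x₀ ∉ translationSpace E ξ)
    {e e' : ℕ → X → X} {A : ℕ → X →L[ℝ] X} {κ : ℕ → ℝ}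
    (hA : ∀ k p q, e k q - e k p = A k (q - p)) (hee' : ∀ k q, e k (e' k q) = q)
    (hsim : ∀ k, IsSimilarityRatio (e k) (κ k))
    (hκ0 : ∀ k, 0 < κ k) (hκ1 : ∀ k, κ k ≠ 1) (hκ : Tendsto κ atTop (𝓝 1))
    (hA1 : Tendsto A atTop (𝓝 1)) (hex : Tendsto (fun k => e k x₀) atTop (𝓝 x₀)) {δ : ℝ}
    (hδ : 0 < δ) (hmaps : ∀ᶠ k in atTop, ∀ q ∈ E, dist q x₀ < δ → e k q ∈ E ∧ e' k q ∈ E) :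
    False := by
  have hτ : 0 < τ := dist_nonneg.trans_lt hx₀τ
  set V := translationSpace E ξ with hV
  set π := Vᗮ.starProjection with hπ
  have hπV : ∀ q, q - π q ∈ V := fun q => by
    rw [hπ, Submodule.starProjection_orthogonal']
    simp [Submodule.starProjection_apply_mem]
  have hππ : ∀ v, π (π v) = π v := fun v =>
    Submodule.starProjection_eq_self_iff.2 (Submodule.starProjection_apply_mem _ _)
  have hπn : ∀ v, ‖π v‖ ≤ ‖v‖ := Submodule.norm_starProjection_apply_le _
  -- all points under consideration lie in a small ball around `x₀`
  obtain ⟨δ₁, hδ₁, hδ₁1, hδ₁δ, hδ₁τ⟩ : ∃ δ₁ > 0, δ₁ ≤ 1 ∧ δ₁ ≤ δ ∧ 2 * δ₁ ≤ τ - dist x₀ ξ :=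
    ⟨min 1 (min δ ((τ - dist x₀ ξ) / 2)),
      lt_min one_pos (lt_min hδ (by linarith)), min_le_left _ _,
      (min_le_right _ _).trans (min_le_left _ _), by
        linarith [(min_le_right 1 (min δ ((τ - dist x₀ ξ) / 2))).trans (min_le_right _ _)]⟩
  have hproj : ∀ q ∈ E, ∀ z ∈ E, dist q x₀ < δ₁ → dist z q < δ₁ → q + π (z - q) ∈ E := by
    intro q hq z hz h1 h2
    have h3 : q + π (z - q) = z + -((z - q) - π (z - q)) := by abel
    rw [h3]
    refine hinv z hz ?_ _ (neg_mem (hπV _)) ?_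
    · linarith [dist_triangle z q ξ, dist_triangle q x₀ ξ]
    · rw [norm_neg]
      have := (norm_sub_le (z - q) (π (z - q))).trans (add_le_add_right (hπn _) _)
      rw [← dist_eq_norm z q] at this
      linarith [dist_nonneg (x := x₀) (y := ξ)]
  -- displacements tend to zero
  set dk : ℕ → ℝ := fun k => ‖e k x₀ - x₀‖ + ‖A k - 1‖ with hdk
  have hdisp : ∀ k q, e k q - q = (e k x₀ - x₀) + (A k - 1) (q - x₀) := fun k q => by
    have := hA k x₀ q
    simp only [sub_apply, one_apply_eq_self, ← this]
    abel
  have hd0 : Tendsto dk atTop (𝓝 0) := by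
    have h1 : Tendsto (fun k => ‖e k x₀ - x₀‖) atTop (𝓝 0) := by
      simpa using (hex.sub_const x₀).norm
    have h2 : Tendsto (fun k => ‖A k - 1‖) atTop (𝓝 0) := by
      simpa using (hA1.sub_const 1).norm
    simpa using h1.add h2
  have he_near : ∀ k q, dist q x₀ < δ₁ → dist (e k q) q ≤ dk k := fun k q hq => by
    rw [dist_eq_norm, hdisp]
    refine (norm_add_le _ _).trans (add_le_add_right ?_ _)
    refine ((A k - 1).le_opNorm _).trans ?_
    rw [← dist_eq_norm q x₀]
    nlinarith [norm_nonneg (A k - 1)]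
  have he'_near : ∀ k q, dist q x₀ < δ₁ → dist (e' k q) q ≤ (κ k)⁻¹ * dk k := fun k q hq => by
    have h1 := hsim k (e' k q) q
    rw [hee', dist_comm q] at h1
    rw [← div_eq_inv_mul, le_div_iff₀ (hκ0 k), mul_comm, ← h1]
    exact he_near k q hq
  have hd'0 : Tendsto (fun k => (κ k)⁻¹ * dk k) atTop (𝓝 0) := by
    simpa using (hκ.inv₀ one_ne_zero).mul hd0
  have hmaps' : ∀ᶠ k in atTop, ∀ q ∈ E, dist q x₀ < δ₁ → e k q ∈ E ∧ e' k q ∈ E :=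
    hmaps.mono fun k hk q hq h => hk q hq (h.trans_le hδ₁δ)
  -- the affine maps describing the displacements transversal to `V`
  set D : Submodule ℝ X := Submodule.span ℝ ((· - x₀) '' (E ∩ Metric.ball x₀ δ₁)) with hD
  set P := D.starProjection with hP
  have hPD : ∀ q ∈ E, dist q x₀ < δ₁ → P (q - x₀) = q - x₀ := fun q hq h =>
    Submodule.starProjection_eq_self_iff.2 (Submodule.subset_span ⟨q, ⟨hq, h⟩, rfl⟩)
  set c : ℕ → X × (X →L[ℝ] X) :=
    fun k => (π (e k x₀ - x₀), (π.comp (A k - 1)).comp P) with hc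
  have hcW : ∀ k, ∀ q ∈ E, dist q x₀ < δ₁ →
      π (e k q - q) = (c k).1 + (c k).2 (q - x₀) := fun k q hq h => by
    rw [hdisp, map_add]
    simp [hc, hPD q hq h]
  have hc0 : Tendsto c atTop (𝓝 0) := by
    have h1 : Tendsto (fun k => π (e k x₀ - x₀)) atTop (𝓝 0) := by
      have := (π.continuous.tendsto _).comp (hex.sub_const x₀)
      rwa [sub_self, map_zero] at this
    have h2 : Tendsto (fun k => (π.comp (A k - 1)).comp P) atTop (𝓝 0) := by
      have h3 : Continuous fun B : X →L[ℝ] X => (π.comp (B - 1)).comp P :=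
        (continuous_const.clm_comp (continuous_id.sub continuous_const)).clm_comp
          continuous_const
      have := (h3.tendsto 1).comp hA1
      rwa [sub_self, ContinuousLinearMap.comp_zero, ContinuousLinearMap.zero_comp] at this
    exact h1.prodMk_nhds h2
  set N : ℕ → ℝ := fun k => ‖c k‖ with hNdef
  have hN : Tendsto N atTop (𝓝 0) := by simpa using hc0.norm
  have hN0 : ∀ᶠ k in atTop, 0 < N k := by
    obtain ⟨y, hy, hyx, hyV⟩ := hnf (δ₁ / 2) (by positivity)
    have hzE : x₀ + π (y - x₀) ∈ E := hproj x₀ hx₀ y hy (by simpa) (by linarith)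
    have hε : 0 < ‖π (y - x₀)‖ := by
      rw [norm_pos_iff]
      intro h
      have := hπV (y - x₀)
      rw [h, sub_zero] at this
      exact hyV this
    have hzx : dist (x₀ + π (y - x₀)) x₀ < δ₁ / 2 := by
      rw [dist_eq_norm, add_sub_cancel_left]
      exact (hπn _).trans_lt (by rwa [← dist_eq_norm])
    filter_upwards [hmaps', hd'0.eventually_lt_const (show 0 < δ₁ / 2 by positivity)]
      with k hk hkd
    rw [hNdef, norm_pos_iff]
    intro hck
    have hW : ∀ q ∈ E, dist q x₀ < δ₁ → π (e k q - q) = 0 := fun q hq h => by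
      rw [hcW k q hq h, hck]; simp
    refine hκ1 k (le_antisymm ?_ ?_)
    · have hnear : ∀ q, dist q x₀ < δ₁ / 2 → dist (e' k q) x₀ < δ₁ := fun q hq => by
        linarith [he'_near k q (by linarith), dist_triangle (e' k q) q x₀]
      have h1 := hW _ (hk _ hzE (by linarith)).2 (hnear _ hzx)
      have h2 := hW _ (hk _ hx₀ (by simpa)).2 (hnear x₀ (by simpa))
      rw [hee'] at h1 h2
      have h3 : π (e' k (x₀ + π (y - x₀)) - e' k x₀) = π (y - x₀) := by
        rw [map_sub, sub_eq_zero] at h1 h2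
        rw [map_sub, ← h1, ← h2, map_add, hππ, add_sub_cancel_left]
      have h4 := hπn (e' k (x₀ + π (y - x₀)) - e' k x₀)
      rw [h3, ← dist_eq_norm (e' k (x₀ + π (y - x₀)))] at h4
      have h5 := hsim k (e' k (x₀ + π (y - x₀))) (e' k x₀)
      rw [hee', hee', dist_eq_norm, add_sub_cancel_left] at h5
      by_contra! hlt
      nlinarith
    · have h1 := hW _ hzE (by linarith)
      have h2 := hW _ hx₀ (by simpa)
      have h3 : π (e k (x₀ + π (y - x₀)) - e k x₀) = π (y - x₀) := by
        rw [map_sub, sub_eq_zero] at h1 h2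
        rw [map_sub, h1, h2, map_add, hππ, add_sub_cancel_left]
      have h4 := hπn (e k (x₀ + π (y - x₀)) - e k x₀)
      rw [h3, ← dist_eq_norm (e k (x₀ + π (y - x₀))), hsim, dist_eq_norm,
        add_sub_cancel_left] at h4
      by_contra! hlt
      nlinarith
  -- a limit of the normalized affine maps
  set K : Set (X × (X →L[ℝ] X)) :=
    Metric.sphere 0 1 ∩ {b | π b.1 = b.1 ∧ π.comp b.2 = b.2 ∧ b.2.comp P = b.2} with hKdef
  have hK : IsCompact K := by
    refine (isCompact_sphere _ _).inter_right (IsClosed.and ?_ (IsClosed.and ?_ ?_))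
    · exact isClosed_eq (π.continuous.comp continuous_fst) continuous_fst
    · exact isClosed_eq (continuous_const.clm_comp continuous_snd) continuous_snd
    · exact isClosed_eq (continuous_snd.clm_comp continuous_const) continuous_snd
  have hπc : π.comp π = π := ContinuousLinearMap.ext hππ
  have hPc : P.comp P = P := ContinuousLinearMap.ext fun v =>
    Submodule.starProjection_eq_self_iff.2 (Submodule.starProjection_apply_mem _ _)
  have hcK : ∃ᶠ k in atTop, (N k)⁻¹ • c k ∈ K := by
    refine (hN0.mono fun k hk => ⟨?_, ?_, ?_, ?_⟩).frequently
    · rw [mem_sphere_zero_iff_norm, norm_smul, norm_inv, Real.norm_of_nonneg hk.le]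
      exact inv_mul_cancel₀ hk.ne'
    · simp [hc, hππ]
    · simp only [hc, Prod.smul_mk, ContinuousLinearMap.comp_smul]
      rw [← ContinuousLinearMap.comp_assoc, ← ContinuousLinearMap.comp_assoc, hπc]
    · simp only [hc, Prod.smul_mk, ContinuousLinearMap.smul_comp]
      rw [ContinuousLinearMap.comp_assoc, hPc]
  obtain ⟨⟨a, L⟩, ⟨hn1, ha, hL, hLP⟩, ψ, hψ, hlim⟩ := hK.tendsto_subseq' hcK
  simp only at ha hL hLP
  -- a copy of `ξ` at which the limit does not vanish
  obtain ⟨q₁, hq₁, hq₁x, hq₁0⟩ : ∃ q ∈ E, dist q x₀ < δ₁ ∧ a + L (q - x₀) ≠ 0 := by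
    by_contra! hall
    have ha0 : a = 0 := by simpa using hall x₀ hx₀ (by simpa)
    have hLD : ∀ v ∈ D, L v = 0 := by
      intro v hv
      induction hv using Submodule.span_induction with
      | mem v hv =>
        obtain ⟨q, ⟨hq, hqx⟩, rfl⟩ := hv
        simpa [ha0] using hall q hq hqx
      | zero => simp
      | add v w _ _ hv hw => rw [map_add, hv, hw, add_zero]
      | smul t v _ hv => rw [map_smul, hv, smul_zero]
    have hL0 : L = 0 := by
      rw [← hLP]
      ext v
      exact hLD _ (Submodule.starProjection_apply_mem _ _)
    rw [ha0, hL0, mem_sphere_zero_iff_norm] at hn1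
    simp at hn1
  obtain ⟨ε₁, hε₁, hε₁0⟩ : ∃ ε₁ > 0, ∀ q, dist q q₁ < ε₁ → a + L (q - x₀) ≠ 0 := by
    have hcont : Continuous fun q => a + L (q - x₀) := by fun_prop
    exact Metric.eventually_nhds_iff.1 ((hcont.tendsto q₁).eventually_ne hq₁0)
  obtain ⟨g, σ, hg, hgq⟩ := H.dense q₁ hq₁ (min ε₁ (δ₁ - dist q₁ x₀))
    (lt_min hε₁ (by linarith))
  rw [lt_min_iff] at hgq
  have hpx : dist (g ξ) x₀ < δ₁ := by linarith [dist_triangle (g ξ) q₁ x₀]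
  refine hε₁0 _ hgq.1 ?_
  set p := g ξ with hp
  set u := a + L (p - x₀) with hu
  have hest : ∀ η > 0, ∃ ρ' > 0, ρ' ≤ δ₁ - dist p x₀ ∧ ∀ᶠ k in atTop, ∀ q ∈ E, dist q p < ρ' →
      ‖(N (ψ k))⁻¹ • π (e (ψ k) q - q) - u‖ ≤ η := by
    intro η hη
    refine ⟨min (δ₁ - dist p x₀) (η / (2 * (‖L‖ + 1))),
      lt_min (by linarith) (by positivity), min_le_left _ _, ?_⟩
    have h1 : Tendsto (fun k => ‖(N (ψ k))⁻¹ • c (ψ k) - (a, L)‖) atTop (𝓝 0) := by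
      simpa using (hlim.sub_const (a, L)).norm
    filter_upwards [h1.eventually_lt_const (show 0 < η / 4 by positivity)] with k hk q hq hqp
    obtain ⟨h2, h3⟩ := lt_min_iff.1 hqp
    rw [lt_div_iff₀ (by positivity)] at h3
    have hqx : dist q x₀ < δ₁ := by linarith [dist_triangle q p x₀]
    rw [hcW _ q hq hqx]
    have h4 := (norm_fst_le ((N (ψ k))⁻¹ • c (ψ k) - (a, L))).trans hk.le
    have h5 := (norm_snd_le ((N (ψ k))⁻¹ • c (ψ k) - (a, L))).trans hk.le
    simp only [Prod.fst_sub, Prod.snd_sub, Prod.smul_fst, Prod.smul_snd] at h4 h5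
    have h6 : (N (ψ k))⁻¹ • ((c (ψ k)).1 + (c (ψ k)).2 (q - x₀)) - u
        = ((N (ψ k))⁻¹ • (c (ψ k)).1 - a) + ((N (ψ k))⁻¹ • (c (ψ k)).2 - L) (q - x₀)
          + L (q - p) := by
      simp only [hu, map_sub, sub_apply, smul_apply,
        smul_add, smul_sub]
      abel
    rw [h6]
    refine norm_add₃_le.trans ?_
    have h7 := ((N (ψ k))⁻¹ • (c (ψ k)).2 - L).le_opNorm (q - x₀)
    have h8 := L.le_opNorm (q - p)
    rw [← dist_eq_norm q] at h7 h8
    nlinarith [norm_nonneg L, norm_nonneg ((N (ψ k))⁻¹ • (c (ψ k)).2 - L),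
      dist_nonneg (x := q) (y := x₀), dist_nonneg (x := q) (y := p)]
  have hψt := hψ.tendsto_atTop
  have hev := hψt.eventually (hmaps'.and hN0)
  refine H.eq_zero_of_displacements hτ hinv hg
    (by linarith [dist_triangle p x₀ ξ]) (hψt.eventually hN0) (hN.comp hψt)
    (w := fun k q => (N (ψ k))⁻¹ • π (e (ψ k) q - q))
    (w' := fun k q => (N (ψ k))⁻¹ • π (e' (ψ k) q - q)) ?_ ?_ ?_
  · intro η hη
    obtain ⟨ρ', hρ', hρδ, h⟩ := hest η hη
    refine ⟨ρ', hρ', ?_⟩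
    filter_upwards [h, hev, hψt.eventually (hd0.eventually_lt_const hδ₁)]
      with k hk ⟨hkm, hkN⟩ hkd q hq hqp
    have hqx : dist q x₀ < δ₁ := by linarith [dist_triangle q p x₀]
    refine ⟨hk q hq hqp, ?_⟩
    rw [smul_inv_smul₀ hkN.ne']
    exact hproj q hq _ (hkm q hq hqx).1 hqx ((he_near _ q hqx).trans_lt hkd)
  · intro η hη
    obtain ⟨ρ', hρ', hρδ, h⟩ := hest η hη
    refine ⟨ρ' / 2, by positivity, ?_⟩
    filter_upwards [h, hev, hψt.eventually (hd'0.eventually_lt_const hδ₁),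
      hψt.eventually (hd'0.eventually_lt_const (show 0 < ρ' / 2 by positivity))]
      with k hk ⟨hkm, hkN⟩ hkd hkd' q hq hqp
    have hqx : dist q x₀ < δ₁ := by linarith [dist_triangle q p x₀]
    have hnear := he'_near (ψ k) q hqx
    constructor
    · have h1 := hk _ (hkm q hq hqx).2 (by linarith [dist_triangle (e' (ψ k) q) q p])
      rw [hee'] at h1
      rw [← norm_neg]
      have h2 : -((N (ψ k))⁻¹ • π (e' (ψ k) q - q) - -u)
          = (N (ψ k))⁻¹ • π (q - e' (ψ k) q) - u := by
        rw [← neg_sub q, map_neg, smul_neg]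
        abel
      rwa [h2]
    · rw [smul_inv_smul₀ hkN.ne']
      exact hproj q hq _ (hkm q hq hqx).2 hqx (hnear.trans_lt hkd)
  · refine Submodule.add_mem _ ?_ ?_
    · exact Submodule.starProjection_eq_self_iff.1 ha
    · exact Submodule.starProjection_eq_self_iff.1 (DFunLike.congr_fun hL (p - x₀))

end NearIdentity

section MinimalBalls

/-- `d` is the least radius of a closed ball centred in `E` that contains `F`. -/
def IsMinRadius {X : Type*} [MetricSpace X] (E F : Set X) (d : ℝ) : Prop :=
  (∃ x ∈ E, F ⊆ Metric.closedBall x d) ∧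
    ∀ x ∈ E, ∀ d', F ⊆ Metric.closedBall x d' → d ≤ d'

/-- `d` is the least radius of a closed ball centred in `E` that contains
`Metric.closedBall x d ∩ E`. -/
structure IsMinBall {X : Type*} [MetricSpace X] (E : Set X) (x : X) (d : ℝ) : Prop where
  mem : x ∈ E
  pos : 0 < d
  le : ∀ x' ∈ E, ∀ d', Metric.closedBall x d ∩ E ⊆ Metric.closedBall x' d' → d ≤ d'

section

variable {X : Type*} [MetricSpace X]

lemma exists_isMinRadius {E F : Set X} (hE : IsCompact E) (hE0 : E.Nonempty)
    (hF : Bornology.IsBounded F) (hF0 : F.Nonempty) : ∃ d, IsMinRadius E F d := by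
  obtain ⟨x₀, hx₀⟩ := hE0
  obtain ⟨q₀, hq₀⟩ := hF0
  obtain ⟨R, hR⟩ := hF.subset_closedBall x₀
  have hR0 : 0 ≤ R := dist_nonneg.trans (hR hq₀)
  set A : Set (X × ℝ) := E ×ˢ Set.Icc 0 R ∩ {b | ∀ q ∈ F, dist q b.1 ≤ b.2} with hA
  have hAc : IsCompact A := by
    refine (hE.prod isCompact_Icc).inter_right ?_
    have : {b : X × ℝ | ∀ q ∈ F, dist q b.1 ≤ b.2} = ⋂ q ∈ F, {b | dist q b.1 ≤ b.2} := by
      ext; simp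
    rw [this]
    exact isClosed_biInter fun q _ =>
      isClosed_le (continuous_const.dist continuous_fst) continuous_snd
  have hA0 : A.Nonempty := ⟨(x₀, R), ⟨hx₀, hR0, le_rfl⟩, fun q hq => hR hq⟩
  obtain ⟨⟨x, d⟩, ⟨⟨hx, hd⟩, hF⟩, hmin⟩ := hAc.exists_isMinOn hA0 continuous_snd.continuousOn
  refine ⟨d, ⟨x, hx, hF⟩, fun x' hx' d' hd' => ?_⟩
  rcases le_or_gt d' R with h | h
  · exact hmin (a := (x', d')) ⟨⟨hx', dist_nonneg.trans (hd' hq₀), h⟩, fun q hq => hd' hq⟩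
  · exact hd.2.trans h.le

/-- If the subsets of `K` have only countably many minimal radii, then a relatively open piece
of `K` lies on a sphere. -/
lemma exists_sphere_of_countable_radii {E K : Set X} (hE : IsCompact E) (hE0 : E.Nonempty)
    (hK : IsCompact K) (hK0 : K.Nonempty)
    (hc : {d | ∃ F ⊆ K, F.Nonempty ∧ IsMinRadius E F d}.Countable) :
    ∃ x c, ∃ y ∈ K, ∃ η > 0, ∀ q ∈ K, dist q y < η → dist q x = c := by
  have : CompactSpace K := isCompact_iff_compactSpace.1 hK
  have : Nonempty K := hK0.to_subtype
  have hex : ∀ F : TopologicalSpace.NonemptyCompacts K,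
      ∃ d, IsMinRadius E ((↑) '' (F : Set K) : Set X) d := fun F =>
    exists_isMinRadius hE hE0 (hK.isBounded.subset (Subtype.coe_image_subset _ _))
      (F.nonempty.image _)
  choose Rad hRad using hex
  have hne : ∀ F G : TopologicalSpace.NonemptyCompacts K,
      Metric.hausdorffEDist (F : Set K) G ≠ ⊤ := fun F G =>
    Metric.hausdorffEDist_ne_top_of_nonempty_of_bounded F.nonempty G.nonempty
      F.isCompact.isBounded G.isCompact.isBounded
  have hlip : LipschitzWith 1 Rad := LipschitzWith.of_le_add fun F G => by
    obtain ⟨x, hx, hG⟩ := (hRad G).1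
    refine le_of_forall_pos_le_add fun ε hε => (hRad F).2 x hx _ ?_
    rintro _ ⟨q, hq, rfl⟩
    obtain ⟨p, hp, hqp⟩ := Metric.exists_dist_lt_of_hausdorffDist_lt hq
      (show _ < dist F G + ε by rw [Metric.NonemptyCompacts.dist_eq]; linarith) (hne F G)
    have h1 : dist (p : X) x ≤ Rad G := hG ⟨p, hp, rfl⟩
    have h2 : dist (q : X) p < dist F G + ε := hqp
    rw [Metric.mem_closedBall]
    linarith [dist_triangle (q : X) p x]
  have hrange : (Set.range Rad).Countable := hc.mono <| by
    rintro _ ⟨F, rfl⟩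
    exact ⟨_, Subtype.coe_image_subset _ _, F.nonempty.image _, hRad F⟩
  have : Countable (Set.range Rad) := hrange.to_subtype
  obtain ⟨⟨c, _⟩, F₀, hF₀⟩ := nonempty_interior_of_iUnion_of_closed
    (f := fun c : Set.range Rad => Rad ⁻¹' {(c : ℝ)})
    (fun c => isClosed_singleton.preimage hlip.continuous)
    (Set.eq_univ_of_forall fun F => Set.mem_iUnion.2 ⟨⟨Rad F, F, rfl⟩, rfl⟩)
  obtain ⟨η, hη, hball⟩ := Metric.isOpen_iff.1 isOpen_interior F₀ hF₀
  have hconst : ∀ F, dist F F₀ < η → Rad F = c := fun F hF =>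
    show F ∈ Rad ⁻¹' {c} from interior_subset (hball hF)
  have hthick : IsCompact (Metric.cthickening (η / 2) (F₀ : Set K)) :=
    Metric.isClosed_cthickening.isCompact
  have hmemthick : ∀ q, q ∈ Metric.cthickening (η / 2) (F₀ : Set K) ↔
      ∃ y ∈ (F₀ : Set K), dist q y ≤ η / 2 := fun q => by
    rw [F₀.isCompact.cthickening_eq_biUnion_closedBall (by positivity)]
    simp
  let F₁ : TopologicalSpace.NonemptyCompacts K :=
    ⟨⟨Metric.cthickening (η / 2) F₀, hthick⟩,
      F₀.nonempty.mono (Metric.self_subset_cthickening _)⟩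
  have hF₁ : Rad F₁ = c := hconst F₁ <| by
    rw [Metric.NonemptyCompacts.dist_eq]
    refine lt_of_le_of_lt (Metric.hausdorffDist_le_of_mem_dist (r := η / 2) (by positivity)
      ?_ ?_) (by linarith)
    · exact fun q hq => (hmemthick q).1 hq
    · exact fun q hq => ⟨q, Metric.self_subset_cthickening _ hq, by simp; positivity⟩
  obtain ⟨x, hx, hxF⟩ := (hRad F₁).1
  rw [hF₁] at hxF
  have hin : ∀ y ∈ (F₀ : Set K), ∀ q : K, dist q y < η / 4 → dist (q : X) x ≤ c :=
    fun y hy q hq => hxF ⟨q, (hmemthick q).2 ⟨y, hy, by linarith⟩, rfl⟩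
  refine ⟨x, c, ?_⟩
  by_contra! hcon
  have hq : ∀ y : K, ∃ q : K, dist q y < η / 4 ∧ dist (q : X) x ≠ c := fun y => by
    obtain ⟨q, hq, h1, h2⟩ := hcon y y.2 (η / 4) (by positivity)
    exact ⟨⟨q, hq⟩, h1, h2⟩
  choose Z hZ hZc using hq
  obtain ⟨t, htF, htfin, hcov⟩ := F₀.isCompact.finite_cover_balls (show 0 < η / 4 by positivity)
  have ht0 : t.Nonempty := by
    obtain ⟨p, hp⟩ := F₀.nonempty
    obtain ⟨y, hy, -⟩ := Set.mem_iUnion₂.1 (hcov hp)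
    exact ⟨y, hy⟩
  let F₂ : TopologicalSpace.NonemptyCompacts K :=
    ⟨⟨Z '' t, (htfin.image Z).isCompact⟩, ht0.image _⟩
  have hF₂ : Rad F₂ = c := hconst F₂ <| by
    rw [Metric.NonemptyCompacts.dist_eq]
    refine lt_of_le_of_lt (Metric.hausdorffDist_le_of_mem_dist (r := η / 2) (by positivity)
      ?_ ?_) (by linarith)
    · rintro _ ⟨y, hy, rfl⟩
      exact ⟨y, htF hy, by linarith [hZ y]⟩
    · intro p hp
      obtain ⟨y, hy, hpy⟩ := Set.mem_iUnion₂.1 (hcov hp)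
      rw [Metric.mem_ball] at hpy
      exact ⟨Z y, ⟨y, hy, rfl⟩, by linarith [hZ y, dist_triangle_right p (Z y) y]⟩
  obtain ⟨y, hy, hmax⟩ := Set.exists_max_image t (fun y => dist (Z y : X) x) htfin ht0
  have h1 := (hRad F₂).2 x hx (dist (Z y : X) x) <| by
    rintro _ ⟨_, ⟨p, hp, rfl⟩, rfl⟩
    exact hmax p hp
  rw [hF₂] at h1
  exact hZc y (le_antisymm (hin y (htF hy) _ (hZ y)) h1)

end

variable {X : Type*} [NormedAddCommGroup X] [InnerProductSpace ℝ X] [FiniteDimensional ℝ X]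
  {E O : Set X} {ξ : X} {φ : X → X} {r : ℝ}

lemma CopyStructure.not_countable_radii (H : CopyStructure E O ξ φ r) {τ : ℝ} (hτ : 0 < τ) :
    ¬ {d | ∃ x, dist x ξ < τ ∧ IsMinBall E x d}.Countable := by
  intro hcount
  obtain ⟨g₀, ρ₀, hg₀, hg₀E⟩ := H.small ξ H.mem (τ / 3) (by positivity)
  obtain ⟨x₁, c, _, ⟨y, hy, rfl⟩, η, hη, h⟩ := exists_sphere_of_countable_radii H.compact
    ⟨ξ, H.mem⟩ (H.compact.image (hg₀.sim.continuous hg₀.pos)) ⟨_, ξ, H.mem, rfl⟩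
    ((hcount.union (Set.countable_singleton 0)).mono (by
      rintro d ⟨F, hFK, ⟨q₀, hq₀⟩, ⟨x, hx, hFx⟩, hmin⟩
      have hd0 : 0 ≤ d := dist_nonneg.trans (hFx hq₀)
      rcases hd0.eq_or_lt with h0 | h0
      · exact Or.inr h0.symm
      have hFball := hFK.trans hg₀E
      have hdτ : d ≤ τ / 3 := hmin ξ H.mem _ (hFball.trans Metric.ball_subset_closedBall)
      refine Or.inl ⟨x, ?_, hx, h0, fun x' hx' d' h' => hmin x' hx' d' fun q hq => ?_⟩
      · have h1 := hFball hq₀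
        have h2 := hFx hq₀
        rw [Metric.mem_ball] at h1
        rw [Metric.mem_closedBall] at h2
        linarith [dist_triangle_left x ξ q₀]
      · refine h' ⟨hFx hq, ?_⟩
        obtain ⟨p, hp, rfl⟩ := hFK hq
        exact hg₀.mapsTo p hp))
  have hρ₀ := hg₀.pos
  obtain ⟨g, ρ, hg, hgy⟩ := H.dense y hy (η / (2 * ρ₀)) (by positivity)
  have hρ := hg.pos
  have hgg := hg₀.comp hg
  rw [lt_div_iff₀ (by positivity)] at hgy
  obtain ⟨c₀, rfl⟩ := hgg.sim.surjective hgg.pos x₁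
  refine H.not_sphere (c := c₀) (R := c / (ρ₀ * ρ)) (τ := η / (2 * (ρ₀ * ρ))) (by positivity)
    fun q hq hqξ => ?_
  rw [lt_div_iff₀ (by positivity)] at hqξ
  rw [eq_div_iff (by positivity), mul_comm, ← hgg.sim]
  refine h _ ⟨g q, hg.mapsTo q hq, rfl⟩ ?_
  rw [Function.comp, hg₀.sim]
  have h1 := dist_triangle (g q) (g ξ) y
  rw [hg.sim] at h1
  nlinarith

end MinimalBalls

section IteratedFunctionSystems

lemma exists_composition_mem_image {X : Type*} {E : Set X} {m : ℕ} {f : Fin m → X → X}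
    {r : Fin m → ℝ} {R : ℝ} (hr : ∀ i, 0 < r i) (hR : ∀ i, r i ≤ R) (hEattr : E = ⋃ i, f i '' E)
    (p : (X → X) → ℝ → Prop) (hid : p id 1) (hpos : ∀ g ρ, p g ρ → 0 < ρ)
    (hcomp : ∀ i g ρ, p g ρ → p (f i ∘ g) (r i * ρ)) (n : ℕ) :
    ∀ x ∈ E, ∃ g ρ, p g ρ ∧ ρ ≤ R ^ n ∧ x ∈ g '' E := by
  induction n with
  | zero => exact fun x hx => ⟨id, 1, hid, by simp, x, hx, rfl⟩
  | succ n ih =>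
    intro x hx
    rw [hEattr] at hx
    obtain ⟨i, y, hy, rfl⟩ := Set.mem_iUnion.1 hx
    obtain ⟨g, ρ, hg, hρ, z, hz, rfl⟩ := ih y hy
    refine ⟨_, _, hcomp i g ρ hg, ?_, z, hz, rfl⟩
    rw [pow_succ']
    exact mul_le_mul (hR i) hρ (hpos g ρ hg).le ((hr i).le.trans (hR i))

variable {X : Type*} [NormedAddCommGroup X] [InnerProductSpace ℝ X] [FiniteDimensional ℝ X]

/-- The strong open set condition provides the local structure around a suitable point. -/
lemma exists_copyStructure {m : ℕ} (hm : 2 ≤ m) {f : Fin m → X → X} {r : Fin m → ℝ}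
    (hr : ∀ i, r i ∈ Set.Ioo (0 : ℝ) 1) (hsim : ∀ i, IsSimilarityRatio (f i) (r i))
    {E : Set X} (hEcomp : IsCompact E) (hEattr : E = ⋃ i, f i '' E)
    {O : Set X} (hOopen : IsOpen O) (hOmap : ∀ i, f i '' O ⊆ O)
    (hOdisj : ∀ i j, i ≠ j → Disjoint (f i '' O) (f j '' O)) (hOE : (O ∩ E).Nonempty) :
    ∃ ξ φ t, CopyStructure E O ξ φ t := by
  obtain ⟨q₀, hq₀O, hq₀E⟩ := hOE
  have : Nonempty (Fin m) := ⟨⟨0, by omega⟩⟩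
  obtain ⟨i₀, hi₀⟩ := Finite.exists_max r
  have hR1 := (hr i₀).2
  have hR0 := (hr i₀).1
  have hfE : ∀ i, ∀ q ∈ E, f i q ∈ E := fun i q hq => by
    rw [hEattr]
    exact Set.mem_iUnion.2 ⟨i, q, hq, rfl⟩
  obtain ⟨M, hM0, hM⟩ : ∃ M > 0, ∀ p ∈ E, ∀ q ∈ E, dist p q ≤ M := by
    obtain ⟨M, hM⟩ := Metric.isBounded_iff.1 hEcomp.isBounded
    exact ⟨max M 1, by positivity, fun p hp q hq => (hM hp hq).trans (le_max_left _ _)⟩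
  have himage : ∀ {g : X → X} {ρ ε : ℝ}, IsSimilarityRatio g ρ → 0 < ρ → ρ * M < ε →
      ∀ x ∈ g '' E, g '' E ⊆ Metric.ball x ε := by
    rintro g ρ ε hg hρ hlt _ ⟨z, hz, rfl⟩ _ ⟨q, hq, rfl⟩
    rw [Metric.mem_ball, hg]
    nlinarith [hM q hq z hz]
  have hpow : ∀ ε > 0, ∃ n : ℕ, r i₀ ^ n * M < ε ∧ r i₀ ^ n < 1 := fun ε hε => by
    obtain ⟨n, hn⟩ := exists_pow_lt_of_lt_one
      (show 0 < min (ε / M) 1 by positivity) hR1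
    obtain ⟨h1, h2⟩ := lt_min_iff.1 hn
    exact ⟨n, by rwa [lt_div_iff₀ hM0] at h1, h2⟩
  have hEO : E ⊆ closure O := by
    intro x hx
    rw [Metric.mem_closure_iff]
    intro ε hε
    obtain ⟨n, hn, -⟩ := hpow ε hε
    obtain ⟨g, ρ, ⟨hρ, hg, hgO⟩, hρn, hxg⟩ := exists_composition_mem_image
      (fun i => (hr i).1) hi₀ hEattr
      (fun g ρ => 0 < ρ ∧ IsSimilarityRatio g ρ ∧ ∀ q ∈ O, g q ∈ O)
      ⟨one_pos, fun x y => by simp, fun q hq => hq⟩ (fun _ _ h => h.1)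
      (fun i g ρ h => ⟨mul_pos (hr i).1 h.1, (hsim i).comp h.2.1,
        fun q hq => hOmap i ⟨_, h.2.2 q hq, rfl⟩⟩) n x hx
    refine ⟨g q₀, hgO q₀ hq₀O, ?_⟩
    rw [dist_comm]
    exact himage hg hρ (by nlinarith) x hxg ⟨q₀, hq₀E, rfl⟩
  have hcopy : ∀ i, SelfCopy E O (f i) (r i) := fun i =>
    { pos := (hr i).1
      sim := hsim i
      mapsTo := hfE i
      mapsO := fun q hq => hOmap i ⟨q, hq, rfl⟩
      reflects := fun q hq hfq => by
        rw [hEattr] at hfq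
        obtain ⟨j, p, hp, hpq⟩ := Set.mem_iUnion.1 hfq
        rcases eq_or_ne i j with rfl | hij
        · rwa [← (hsim i).injective (hr i).1 hpq]
        · have h1 : f j p ∈ closure (f j '' O) :=
            image_closure_subset_closure_image ((hsim j).continuous (hr j).1) ⟨p, hEO hp, rfl⟩
          have h2 := (hOdisj i j hij).closure_right ((hsim i).isOpenMap (hr i).1 O hOopen)
          rw [hpq] at h1
          exact (Set.disjoint_left.1 h2 ⟨q, hq, rfl⟩ h1).elim }
  have hsmall : ∀ x ∈ E, ∀ ε > 0, ∃ g ρ, SelfCopy E O g ρ ∧ ρ < 1 ∧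
      g '' E ⊆ Metric.ball x ε := fun x hx ε hε => by
    obtain ⟨n, hn, hn1⟩ := hpow ε hε
    obtain ⟨g, ρ, hg, hρn, hxg⟩ := exists_composition_mem_image
      (fun i => (hr i).1) hi₀ hEattr (fun g ρ => SelfCopy E O g ρ)
      ⟨one_pos, fun x y => by simp, fun q hq => hq, fun q hq => hq, fun q _ hq => hq⟩
      (fun _ _ h => h.pos) (fun i g ρ h => (hcopy i).comp h) n x hx
    exact ⟨g, ρ, hg, hρn.trans_lt hn1, himage hg.sim hg.pos (by nlinarith) x hxg⟩
  obtain ⟨δ, hδ, hδO⟩ := Metric.isOpen_iff.1 hOopen q₀ hq₀O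
  obtain ⟨φ, t, hφ, ht1, hφE⟩ := hsmall q₀ hq₀E δ hδ
  have hcontr : ContractingWith ⟨t, hφ.pos.le⟩ φ :=
    ⟨ht1, LipschitzWith.of_dist_le_mul fun x y => (hφ.sim x y).le⟩
  have hfix := hcontr.fixedPoint_isFixedPt
  set ξ := ContractingWith.fixedPoint φ hcontr with hξ
  have hξE : ξ ∈ E := by
    refine hEcomp.isClosed.mem_of_tendsto (hcontr.tendsto_iterate_fixedPoint q₀) ?_
    exact Eventually.of_forall fun j => (hφ.iterate j).mapsTo q₀ hq₀E
  have hξO : ξ ∈ O := hδO (hφE ⟨ξ, hξE, hfix⟩)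
  refine ⟨ξ, φ, t, hEcomp, hOopen, hξE, hξO, hφ, ht1, hfix, ?_, ?_, ?_⟩
  · intro x hx ε hε
    obtain ⟨g, ρ, hg, -, hgE⟩ := hsmall x hx ε hε
    exact ⟨g, ρ, hg, hgE ⟨ξ, hξE, rfl⟩⟩
  · intro x hx ε hε
    obtain ⟨g, ρ, hg, -, hgE⟩ := hsmall x hx ε hε
    exact ⟨g, ρ, hg, hgE⟩
  · by_contra! hall
    have hij : (⟨0, by omega⟩ : Fin m) ≠ ⟨1, by omega⟩ := by simp
    exact Set.disjoint_left.1 (hOdisj _ _ hij) ⟨ξ, hξO, hall _ (hfE _ ξ hξE)⟩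
      ⟨ξ, hξO, hall _ (hfE _ ξ hξE)⟩

end IteratedFunctionSystems

section SimilarBalls

lemma IsMinBall.le_mul_of_image {X : Type*} [MetricSpace X] {E : Set X} {x x' : X} {d d' : ℝ}
    (hb : IsMinBall E x d) (hb' : IsMinBall E x' d') {e : X → X} {κ : ℝ} (hκ : 0 < κ)
    (he : IsSimilarityRatio e κ)
    (him : e '' (Metric.closedBall x d ∩ E) = Metric.closedBall x' d' ∩ E) : d' ≤ κ * d := by
  have hx : e x ∈ Metric.closedBall x' d' ∩ E := by
    rw [← him]
    exact ⟨x, ⟨by simpa using hb.pos.le, hb.mem⟩, rfl⟩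
  refine hb'.le _ hx.2 _ ?_
  rw [← him]
  rintro _ ⟨q, ⟨hq, -⟩, rfl⟩
  rw [Metric.mem_closedBall, he]
  exact mul_le_mul_of_nonneg_left hq hκ.le

/-- An injective map from an uncountable type to a second countable metric space accumulates
at one of its values. -/
lemma exists_seq_tendsto_of_uncountable {ι Y : Type*} [Uncountable ι] [MetricSpace Y]
    [SecondCountableTopology Y] {θ : ι → Y} (hθ : Function.Injective θ) :
    ∃ (a : ι) (b : ℕ → ι), (∀ k, b k ≠ a) ∧ Tendsto (fun k => θ (b k)) atTop (𝓝 (θ a)) := by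
  by_contra! hcon
  have hiso : ∀ a, ∃ ε > 0, ∀ b, dist (θ b) (θ a) < ε → b = a := by
    intro a
    by_contra! h
    choose b hb hba using fun k : ℕ => h (1 / ((k : ℝ) + 1)) (by positivity)
    refine hcon a b hba (tendsto_iff_dist_tendsto_zero.2 ?_)
    exact squeeze_zero (fun _ => dist_nonneg) (fun k => (hb k).le)
      tendsto_one_div_add_atTop_nhds_zero_nat
  let _ : MetricSpace ι := MetricSpace.induced θ hθ inferInstance
  have : SecondCountableTopology ι := TopologicalSpace.secondCountableTopology_induced ι Y θ
  have : DiscreteTopology ι := discreteTopology_iff_isOpen_singleton.2 fun a => by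
    obtain ⟨ε, hε, h⟩ := hiso a
    exact Metric.isOpen_iff.2 fun b hb => ⟨ε, hε, fun c hc => by
      rw [Set.mem_singleton_iff.1 hb] at hc
      exact h c hc⟩
  exact not_countable (α := ι) countable_of_Lindelof_of_discrete

variable {X : Type*} [NormedAddCommGroup X] [InnerProductSpace ℝ X] [FiniteDimensional ℝ X]
  {E O : Set X} {ξ : X} {φ : X → X} {r : ℝ}

/-- In a nowhere flat self-similar set, a family of minimal balls with distinct radii which are
all similar to each other is countable. -/
lemma CopyStructure.countable_of_similar (H : CopyStructure E O ξ φ r) {τ : ℝ}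
    (hinv : ∀ q ∈ E, dist q ξ < τ → ∀ v ∈ translationSpace E ξ, ‖v‖ < τ → q + v ∈ E)
    (hnf : ∀ x ∈ E, dist x ξ < τ →
      ∀ ρ > 0, ∃ y ∈ E, dist y x < ρ ∧ y - x ∉ translationSpace E ξ)
    {S : Set (X × ℝ)} (hS : ∀ b ∈ S, dist b.1 ξ < τ ∧ IsMinBall E b.1 b.2)
    (hinj : Set.InjOn Prod.snd S) {C : Set X}
    (hC : ∀ b ∈ S, ∃ h κ, 0 < κ ∧ IsSimilarityRatio h κ ∧
      h '' C = Metric.closedBall b.1 b.2 ∩ E) : S.Countable := by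
  by_contra hunc
  have : Uncountable S := by rwa [← not_countable_iff, Set.countable_coe_iff]
  choose h κ hκ hh him using fun b : S => hC b b.2
  choose Q hQ using fun b => (hh b).exists_linearIsometryEquiv (hκ b)
  have hlin : ∀ b q, h b q = h b 0 + κ b • Q b q := fun b q => by
    rw [hQ b 0 q, sub_zero]
  let M : S → X →L[ℝ] X := fun b => κ b • (Q b : X →L[ℝ] X)
  let inv : S → X → X := fun b y => (κ b)⁻¹ • (Q b).symm (y - h b 0)
  have hinv1 : ∀ b q, h b (inv b q) = q := fun b q => by
    have hQinv : κ b • Q b (inv b q) = q - h b 0 := by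
      simp only [inv, map_smul, LinearIsometryEquiv.apply_symm_apply, smul_inv_smul₀ (hκ b).ne']
    rw [hlin, hQinv]
    abel
  have hinv2 : ∀ b q, inv b (h b q) = q := fun b q => by
    simp [hlin b q, inv, smul_smul, (hκ b).ne']
  have hinvsim : ∀ b, IsSimilarityRatio (inv b) (κ b)⁻¹ := fun b x y => by
    have := hh b (inv b x) (inv b y)
    rw [hinv1, hinv1] at this
    rw [this, inv_mul_cancel_left₀ (hκ b).ne']
  have himinv : ∀ b : S, inv b '' (Metric.closedBall (b : X × ℝ).1 (b : X × ℝ).2 ∩ E) = C :=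
    fun b => by
      rw [← him, Set.image_image]
      simp [hinv2]
  let θ : S → (X × (X →L[ℝ] X)) × (X × ℝ) := fun b => ((h b 0, M b), (b : X × ℝ))
  have hθ : Function.Injective θ := fun b b' hbb => Subtype.ext (congrArg Prod.snd hbb)
  have : SecondCountableTopology ((X × (X →L[ℝ] X)) × (X × ℝ)) :=
    secondCountable_of_proper
  obtain ⟨a, b, hba, hlim⟩ := exists_seq_tendsto_of_uncountable hθ
  have hlim0 : Tendsto (fun k => h (b k) 0) atTop (𝓝 (h a 0)) :=
    (hlim.fst_nhds).fst_nhds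
  have hlimM : Tendsto (fun k => M (b k)) atTop (𝓝 (M a)) := (hlim.fst_nhds).snd_nhds
  have hlimx : Tendsto (fun k => (b k : X × ℝ).1) atTop (𝓝 (a : X × ℝ).1) :=
    (hlim.snd_nhds).fst_nhds
  have hlimd : Tendsto (fun k => (b k : X × ℝ).2) atTop (𝓝 (a : X × ℝ).2) :=
    (hlim.snd_nhds).snd_nhds
  obtain ⟨haξ, hamin⟩ := hS a a.2
  have hd0 := hamin.pos
  have himk : ∀ b b' : S, (h b' ∘ inv b) '' (Metric.closedBall (b : X × ℝ).1 (b : X × ℝ).2 ∩ E)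
      = Metric.closedBall (b' : X × ℝ).1 (b' : X × ℝ).2 ∩ E := fun b b' => by
    rw [Set.image_comp, himinv, him]
  have hκd : ∀ k, κ (b k) * (κ a)⁻¹ = (b k : X × ℝ).2 / (a : X × ℝ).2 := fun k => by
    have h1 := hamin.le_mul_of_image (hS (b k) (b k).2).2
      (mul_pos (hκ _) (inv_pos.2 (hκ _))) ((hh (b k)).comp (hinvsim a)) (himk a (b k))
    have h2 := (hS (b k) (b k).2).2.le_mul_of_image hamin
      (mul_pos (hκ _) (inv_pos.2 (hκ _))) ((hh a).comp (hinvsim (b k))) (himk (b k) a)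
    have h3 := hκ a
    have h4 := hκ (b k)
    rw [eq_div_iff hd0.ne']
    refine le_antisymm ?_ h1
    rw [← div_eq_mul_inv, div_mul_eq_mul_div, le_div_iff₀ h4] at h2
    rw [← div_eq_mul_inv, div_mul_eq_mul_div, div_le_iff₀ h3]
    linarith
  refine H.false_of_similarities_near_id hinv hamin.mem haξ (hnf _ hamin.mem haξ)
    (e := fun k => h (b k) ∘ inv a) (e' := fun k => h a ∘ inv (b k))
    (A := fun k => (M (b k)).comp ((κ a)⁻¹ • ((Q a).symm : X →L[ℝ] X)))
    (κ := fun k => κ (b k) * (κ a)⁻¹) (δ := (a : X × ℝ).2 / 2)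
    ?_ ?_ (fun k => (hh _).comp (hinvsim _)) (fun k => mul_pos (hκ _) (inv_pos.2 (hκ _)))
    ?_ ?_ ?_ ?_ (by positivity) ?_
  · intro k p q
    have hsub : inv a q - inv a p = (κ a)⁻¹ • (Q a).symm (q - p) := by
      simp only [inv, ← smul_sub, ← map_sub, sub_sub_sub_cancel_right]
    change h (b k) (inv a q) - h (b k) (inv a p)
      = κ (b k) • Q (b k) ((κ a)⁻¹ • (Q a).symm (q - p))
    rw [hQ (b k) (inv a p) (inv a q), hsub, add_sub_cancel_left]
  · intro k q
    simp [hinv1, hinv2]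
  · intro k hk
    rw [hκd, div_eq_one_iff_eq hd0.ne'] at hk
    exact hba k (Subtype.ext (hinj (b k).2 a.2 hk))
  · simp only [hκd]
    simpa [hd0.ne'] using hlimd.div_const (a : X × ℝ).2
  · have h1 : Continuous fun B : X →L[ℝ] X =>
        B.comp ((κ a)⁻¹ • ((Q a).symm : X →L[ℝ] X)) := continuous_id.clm_comp continuous_const
    have h2 : (M a).comp ((κ a)⁻¹ • ((Q a).symm : X →L[ℝ] X)) = 1 := by
      ext v
      simp [M, smul_smul, (hκ a).ne']
    have h3 := (h1.tendsto (M a)).comp hlimM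
    rwa [h2] at h3
  · have h1 : Tendsto (fun k => h (b k) 0 + M (b k) (inv a (a : X × ℝ).1)) atTop
        (𝓝 (h a 0 + M a (inv a (a : X × ℝ).1))) :=
      hlim0.add
        (((ContinuousLinearMap.apply ℝ X (inv a (a : X × ℝ).1)).continuous.tendsto _).comp hlimM)
    have h2 : ∀ b q, h b 0 + M b q = h b q := fun b q => (hlin b q).symm
    simpa only [Function.comp_apply, h2, hinv1] using h1
  · have h1 : ∀ᶠ k in atTop, dist (a : X × ℝ).1 (b k : X × ℝ).1 + (a : X × ℝ).2 / 2
        < (b k : X × ℝ).2 := by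
      have h2 : Tendsto (fun k => dist (a : X × ℝ).1 (b k : X × ℝ).1 + (a : X × ℝ).2 / 2) atTop
          (𝓝 (0 + (a : X × ℝ).2 / 2)) := by
        refine Tendsto.add_const _ ?_
        simpa using (tendsto_const_nhds (x := (a : X × ℝ).1)).dist hlimx
      exact h2.eventually_lt hlimd (by linarith)
    filter_upwards [h1] with k hk q hq hqx
    constructor
    · have : (h (b k) ∘ inv a) q ∈ Metric.closedBall (b k : X × ℝ).1 (b k : X × ℝ).2 ∩ E := by
        rw [← himk a (b k)]
        exact ⟨q, ⟨Metric.mem_closedBall.2 (by linarith), hq⟩, rfl⟩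
      exact this.2
    · have : (h a ∘ inv (b k)) q ∈ Metric.closedBall (a : X × ℝ).1 (a : X × ℝ).2 ∩ E := by
        rw [← himk (b k) a]
        refine ⟨q, ⟨Metric.mem_closedBall.2 ?_, hq⟩, rfl⟩
        linarith [dist_triangle q (a : X × ℝ).1 (b k : X × ℝ).1]
      exact this.2

lemma IsMinBall.sphDiam_eq {n : ℕ} {E : Set (EuclideanSpace ℝ (Fin n))}
    {x : EuclideanSpace ℝ (Fin n)} {d : ℝ} (h : IsMinBall E x d) :
    sphDiam E (Metric.closedBall x d ∩ E) = 2 * d := by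
  refine IsLeast.csInf_eq ⟨⟨x, ⟨by simpa using h.pos.le, h.mem⟩, d, h.pos, rfl, rfl⟩, ?_⟩
  rintro _ ⟨x', hx', d', -, hC, rfl⟩
  have := h.le x' hx'.2 d' (by rw [hC]; exact Set.inter_subset_left)
  linarith

/-- Two sets are similar if a surjective similarity maps one onto the other. -/
def similarSetoid {ι : Type*} (C : ι → Set X) : Setoid ι where
  r a b := ∃ (g : X → X) (ρ : ℝ), 0 < ρ ∧ IsSimilarityRatio g ρ ∧ Function.Surjective g ∧
    g '' C a = C b
  iseqv :=
    { refl := fun a => ⟨id, 1, one_pos, fun x y => by simp, Function.surjective_id, by simp⟩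
      symm := by
        rintro a b ⟨g, ρ, hρ, hg, hs, him⟩
        have hl := Function.leftInverse_surjInv ⟨hg.injective hρ, hs⟩
        have hr := Function.rightInverse_surjInv hs
        refine ⟨Function.surjInv hs, ρ⁻¹, by positivity, fun x y => ?_, hl.surjective, ?_⟩
        · have := hg (Function.surjInv hs x) (Function.surjInv hs y)
          rw [hr, hr] at this
          rw [this, inv_mul_cancel_left₀ hρ.ne']
        · rw [← him, hl.image_image]
      trans := by
        rintro a b c ⟨g, ρ, hρ, hg, hs, him⟩ ⟨g', ρ', hρ', hg', hs', him'⟩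
        exact ⟨g' ∘ g, ρ' * ρ, by positivity, hg'.comp hg, hs'.comp hs, by
          rw [Set.image_comp, him, him']⟩ }

end SimilarBalls

/-- A setoid with countable classes on an uncountable type has uncountably many classes. -/
lemma uncountable_quotient_of_countable_classes {ι : Type*} [Uncountable ι] (R : Setoid ι)
    (h : ∀ a, {b | R a b}.Countable) : Uncountable (Quotient R) := by
  rw [← not_countable_iff]
  intro hQ
  refine not_countable (α := ι) (Set.countable_univ_iff.1 ?_)
  refine (Set.countable_iUnion fun c : Quotient R => h c.out).mono fun b _ => ?_
  exact Set.mem_iUnion.2 ⟨⟦b⟧, Quotient.mk_out b⟩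

/-- for a self-similar set `E` with the SOSC whose similarity dimension is
not an integer, there are uncountably many similarity-equivalence classes of proper
restricted balls of `E`: an uncountable family of proper restricted balls, pairwise
distinct as sets, no two of which are mapped onto each other by a surjective similarity. -/
theorem stmt15 {n m : ℕ} (hn : 1 ≤ n) (hm : 2 ≤ m)
    (f : Fin m → EuclideanSpace ℝ (Fin n) → EuclideanSpace ℝ (Fin n))
    (r : Fin m → ℝ) (hr : ∀ i, r i ∈ Set.Ioo (0 : ℝ) 1)
    (hsim : ∀ i, IsSimilarityRatio (f i) (r i))
    (E : Set (EuclideanSpace ℝ (Fin n))) (hEcomp : IsCompact E) (hEne : E.Nonempty)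
    (hEattr : E = ⋃ i, f i '' E)
    (O : Set (EuclideanSpace ℝ (Fin n))) (hOopen : IsOpen O) (hOne : O.Nonempty)
    (hOmap : ∀ i, f i '' O ⊆ O)
    (hOdisj : ∀ i j, i ≠ j → Disjoint (f i '' O) (f j '' O))
    (hOE : (O ∩ E).Nonempty)
    (s : ℝ) (hs : ∑ i, (r i) ^ s = 1)
    (hsnotint : ∀ z : ℤ, s ≠ (z : ℝ)) :
    ∃ T : Set (EuclideanSpace ℝ (Fin n) × ℝ),
      ¬ T.Countable ∧
      (∀ b ∈ T, b.1 ∈ E ∧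
        sphDiam E (Metric.closedBall b.1 b.2 ∩ E) = 2 * b.2) ∧
      Set.InjOn (fun b : EuclideanSpace ℝ (Fin n) × ℝ =>
        Metric.closedBall b.1 b.2 ∩ E) T ∧
      ∀ b ∈ T, ∀ b' ∈ T, b ≠ b' →
        ¬ ∃ (g : EuclideanSpace ℝ (Fin n) → EuclideanSpace ℝ (Fin n)) (ρ : ℝ),
            0 < ρ ∧ IsSimilarityRatio g ρ ∧ Function.Surjective g ∧
            g '' (Metric.closedBall b.1 b.2 ∩ E) = Metric.closedBall b'.1 b'.2 ∩ E := by
  obtain ⟨ξ, φ, t, H⟩ :=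
    exists_copyStructure hm hr hsim hEcomp hEattr hOopen hOmap hOdisj hOE
  obtain ⟨τ, hτ, hinv⟩ := exists_forall_add_mem E ξ
  have hnf : ∀ x ∈ E, dist x ξ < τ →
      ∀ ρ > 0, ∃ y ∈ E, dist y x < ρ ∧ y - x ∉ translationSpace E ξ := by
    intro x hx hxξ ρ hρ
    by_contra! hflat
    have := H.eq_finrank_of_flat (by omega) hr hsim hEattr hOmap hOdisj hs hx
      (translationSpace E ξ) (lt_min hρ hτ) fun y hy => by
        rw [Metric.mem_ball, lt_min_iff] at hy
        refine ⟨fun hyE => hflat y hyE hy.1, fun hv => ?_⟩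
        simpa using hinv x hx hxξ (y - x) hv (by rw [← dist_eq_norm]; exact hy.2)
    exact hsnotint (Module.finrank ℝ (translationSpace E ξ)) (by exact_mod_cast this)
  let D : Set ℝ := {d | ∃ x, dist x ξ < τ ∧ IsMinBall E x d}
  have hD : Uncountable D := by
    rw [← not_countable_iff, Set.countable_coe_iff]
    exact H.not_countable_radii hτ
  choose x hx using fun d : D => d.2
  let C : D → Set (EuclideanSpace ℝ (Fin n)) := fun d => Metric.closedBall (x d) d ∩ E
  let R : Setoid D := similarSetoid C
  have hR : ∀ a, {b | R a b}.Countable := fun a => by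
    have hinj : Function.Injective fun d : D => (x d, (d : ℝ)) := fun d d' h =>
      Subtype.ext (congrArg Prod.snd h)
    refine Set.countable_of_injective_of_countable_image hinj.injOn
      (H.countable_of_similar hinv hnf (C := C a) ?_ ?_ ?_)
    · rintro _ ⟨d, -, rfl⟩
      exact hx d
    · rintro _ ⟨d, -, rfl⟩ _ ⟨d', -, rfl⟩ h
      exact congrArg (fun d : D => (x d, (d : ℝ))) (Subtype.ext h)
    · rintro _ ⟨d, ⟨g, ρ, hρ, hg, -, him⟩, rfl⟩
      exact ⟨g, ρ, hρ, hg, him⟩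
  have := uncountable_quotient_of_countable_classes R hR
  let θ : Quotient R → EuclideanSpace ℝ (Fin n) × ℝ := fun c => (x c.out, (c.out : ℝ))
  have hθ : Function.Injective θ := fun c c' h =>
    Quotient.out_injective (Subtype.ext (congrArg Prod.snd h))
  have hsep : ∀ c c' : Quotient R, R c.out c'.out → c = c' := fun c c' h =>
    Quotient.out_equiv_out.1 h
  refine ⟨Set.range θ, ?_, ?_, ?_, ?_⟩
  · intro hcount
    rw [← Set.image_univ] at hcount
    exact not_countable (α := Quotient R) (Set.countable_univ_iff.1
      (Set.countable_of_injective_of_countable_image hθ.injOn hcount))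
  · rintro _ ⟨c, rfl⟩
    exact ⟨(hx c.out).2.mem, (hx c.out).2.sphDiam_eq⟩
  · rintro _ ⟨c, rfl⟩ _ ⟨c', rfl⟩ h
    refine congrArg θ (hsep c c' ⟨id, 1, one_pos, fun x y => by simp,
      Function.surjective_id, ?_⟩)
    rw [Set.image_id]
    exact h
  · rintro _ ⟨c, rfl⟩ _ ⟨c', rfl⟩ hne hsimilar
    exact hne (congrArg θ (hsep c c' hsimilar))
end
end

section
/- Let S be the Sierpinski gasket with natural measure μ, and for k ≥ 1 let μ_k be the k-th discrete approximation of μ. Then for every k ≥ 1, every x ∈ ℝ², and every d with 2^{−k} < d ≤ max{‖z₀ − x‖, ‖z₁ − x‖, ‖z₂ − x‖}: μ_k(B(x, d − 2^{−k})) ≤ μ(B(x, d)) ≤ μ_k(B̊(x, d + 2^{−k})). -/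
open MeasureTheory Filter Topology
open scoped ENNReal

noncomputable section

/-- The point `(a, b)` of the Euclidean plane. -/
def pt (a b : ℝ) : EuclideanSpace ℝ (Fin 2) :=
  (WithLp.equiv 2 (Fin 2 → ℝ)).symm ![a, b]

/-- The three contracting similarities generating the Sierpinski gasket. -/
def sierf : Fin 3 → EuclideanSpace ℝ (Fin 2) → EuclideanSpace ℝ (Fin 2) :=
  ![fun v => (1/2 : ℝ) • v,
    fun v => (1/2 : ℝ) • v + pt (1/2) 0,
    fun v => (1/2 : ℝ) • v + pt (1/4) (Real.sqrt 3 / 4)]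

/-- The vertices `z₀, z₁, z₂` of the Sierpinski gasket. -/
def vert : Fin 3 → EuclideanSpace ℝ (Fin 2) :=
  ![pt 0 0, pt 1 0, pt (1/2) (Real.sqrt 3 / 2)]

/-- The composition `f_{i₁} ∘ ⋯ ∘ f_{i_k}` associated with a finite word. -/
def wordMap {X : Type*} {m : ℕ} (f : Fin m → X → X) : List (Fin m) → X → X
  | [] => id
  | j :: l => f j ∘ wordMap f l

/-- The `k`-th discrete approximation
`μ_k = 3^{-k} Σ_{i word of length k-1} Σ_{j} δ_{f_i(z_j)}` of the natural measure. -/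
def muK (k : ℕ) : Measure (EuclideanSpace ℝ (Fin 2)) :=
  ((3 : ℝ≥0∞) ^ k)⁻¹ •
    ∑ w : Fin (k - 1) → Fin 3, ∑ j : Fin 3,
      Measure.dirac (wordMap sierf (List.ofFn w) (vert j))

theorem sierf_apply (i : Fin 3) (v : EuclideanSpace ℝ (Fin 2)) :
    sierf i v = (1 / 2 : ℝ) • (v + vert i) := by
  fin_cases i <;> ext m <;> fin_cases m <;> simp [sierf, vert, pt] <;> ring

theorem sierf_vert (i : Fin 3) : sierf i (vert i) = vert i := by
  rw [sierf_apply, ← two_smul ℝ (vert i), smul_smul]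
  norm_num

theorem dist_sierf (i : Fin 3) (u v : EuclideanSpace ℝ (Fin 2)) :
    dist (sierf i u) (sierf i v) = 2⁻¹ * dist u v := by
  rw [sierf_apply, sierf_apply, dist_smul₀, dist_add_right]
  norm_num

theorem dist_wordMap_sierf (l : List (Fin 3)) (u v : EuclideanSpace ℝ (Fin 2)) :
    dist (wordMap sierf l u) (wordMap sierf l v) = (2 ^ l.length)⁻¹ * dist u v := by
  induction l with
  | nil => simp [wordMap]
  | cons j l ih =>
    simp only [wordMap, Function.comp_apply, dist_sierf, ih, List.length_cons, pow_succ, mul_inv]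
    ring

theorem continuous_sierf (i : Fin 3) : Continuous (sierf i) := by
  simp only [funext (sierf_apply i)]
  fun_prop

theorem continuous_wordMap_sierf (l : List (Fin 3)) : Continuous (wordMap sierf l) := by
  induction l with
  | nil => exact continuous_id
  | cons j l ih => exact (continuous_sierf j).comp ih

theorem dist_sq_plane (u v : EuclideanSpace ℝ (Fin 2)) :
    dist u v ^ 2 = (u 0 - v 0) ^ 2 + (u 1 - v 1) ^ 2 := by
  rw [EuclideanSpace.dist_eq, Real.sq_sqrt (by positivity)]
  simp [Fin.sum_univ_two, Real.dist_eq, sq_abs]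

theorem dist_vert_le_one (i j : Fin 3) : dist (vert i) (vert j) ≤ 1 := by
  have h3 : Real.sqrt 3 ^ 2 = 3 := Real.sq_sqrt (by norm_num)
  refine (sq_le_sq₀ dist_nonneg zero_le_one).1 ?_
  rw [dist_sq_plane]
  fin_cases i <;> fin_cases j <;> simp [vert, pt] <;> nlinarith

theorem exists_half_lt_dist_vert (y : EuclideanSpace ℝ (Fin 2)) :
    ∃ i, 1 / 2 < dist y (vert i) := by
  by_contra! h
  have h3 : Real.sqrt 3 ^ 2 = 3 := Real.sq_sqrt (by norm_num)
  have hsq (i : Fin 3) : dist y (vert i) ^ 2 ≤ (1 / 2) ^ 2 :=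
    pow_le_pow_left₀ dist_nonneg (h i) 2
  have h0 := hsq 0
  have h1 := hsq 1
  have h2 := hsq 2
  rw [dist_sq_plane] at h0 h1 h2
  simp [vert, pt] at h0 h1 h2
  nlinarith [sq_nonneg (y 0 - 1 / 2), sq_nonneg (y 1 - Real.sqrt 3 / 6)]

theorem dist_vert_le_one_of_attractor {S : Set (EuclideanSpace ℝ (Fin 2))} (hSc : IsCompact S)
    (hSattr : S = ⋃ i, sierf i '' S) {y : EuclideanSpace ℝ (Fin 2)} (hy : y ∈ S) (j : Fin 3) :
    dist y (vert j) ≤ 1 := by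
  have hcont : Continuous fun p : EuclideanSpace ℝ (Fin 2) × Fin 3 => dist p.1 (vert p.2) :=
    continuous_fst.dist ((continuous_of_discreteTopology (f := vert)).comp continuous_snd)
  obtain ⟨⟨y₀, j₀⟩, ⟨hy₀, -⟩, hmax⟩ := (hSc.prod isCompact_univ).exists_isMaxOn
    ⟨(y, j), hy, Set.mem_univ j⟩ hcont.continuousOn
  have hle (u) (hu : u ∈ S) (i : Fin 3) : dist u (vert i) ≤ dist y₀ (vert j₀) :=
    hmax (a := (u, i)) ⟨hu, Set.mem_univ i⟩
  rw [hSattr] at hy₀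
  obtain ⟨i, u, hu, hui⟩ := Set.mem_iUnion.1 hy₀
  have htri := dist_triangle y₀ (sierf i (vert j₀)) (vert j₀)
  have hmid : dist (sierf i (vert j₀)) (vert j₀) = 2⁻¹ * dist (vert i) (vert j₀) := by
    rw [← dist_sierf j₀, sierf_vert, sierf_apply i, sierf_apply j₀, add_comm]
  have hcell : dist y₀ (sierf i (vert j₀)) = 2⁻¹ * dist u (vert j₀) := by
    rw [show y₀ = sierf i u from hui.symm, dist_sierf]
  linarith [hle u hu j₀, hle y hy j, dist_vert_le_one i j₀]

theorem measure_eq_sum_sierf {μ : Measure (EuclideanSpace ℝ (Fin 2))}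
    (hinv : μ = (3 : ℝ≥0∞)⁻¹ • (μ.map (sierf 0) + μ.map (sierf 1) + μ.map (sierf 2)))
    {A : Set (EuclideanSpace ℝ (Fin 2))} (hA : MeasurableSet A) :
    μ A = 3⁻¹ * ∑ i, μ (sierf i ⁻¹' A) := by
  conv_lhs => rw [hinv]
  simp [Fin.sum_univ_three, mul_add, Measure.map_apply (continuous_sierf _).measurable hA]

theorem measure_eq_sum_wordMap {μ : Measure (EuclideanSpace ℝ (Fin 2))}
    (hinv : μ = (3 : ℝ≥0∞)⁻¹ • (μ.map (sierf 0) + μ.map (sierf 1) + μ.map (sierf 2)))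
    (n : ℕ) {A : Set (EuclideanSpace ℝ (Fin 2))} (hA : MeasurableSet A) :
    μ A = (3 ^ n)⁻¹ * ∑ w : Fin n → Fin 3, μ (wordMap sierf (List.ofFn w) ⁻¹' A) := by
  induction n generalizing A with
  | zero => simp [wordMap]
  | succ n ih =>
    rw [measure_eq_sum_sierf hinv hA, pow_succ',
      ENNReal.mul_inv (Or.inl (by norm_num)) (Or.inl (by norm_num)), mul_assoc,
      ← (Fin.consEquiv fun _ => Fin 3).sum_comp, Fintype.sum_prod_type]
    congr 1
    rw [Finset.mul_sum]
    refine Finset.sum_congr rfl fun i _ => ?_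
    rw [ih ((continuous_sierf i).measurable hA)]
    simp [Fin.consEquiv, wordMap, List.ofFn_succ, Set.preimage_comp]

theorem nullSingletonClass_of_attractor {μ : Measure (EuclideanSpace ℝ (Fin 2))}
    (hinv : μ = (3 : ℝ≥0∞)⁻¹ • (μ.map (sierf 0) + μ.map (sierf 1) + μ.map (sierf 2)))
    [IsProbabilityMeasure μ] {S : Set (EuclideanSpace ℝ (Fin 2))}
    (hSc : IsCompact S) (hSattr : S = ⋃ i, sierf i '' S) (hsupp : μ Sᶜ = 0) : NullSingletonClass μ := by
  set a := ⨆ y, μ {y}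
  have hatom (y) : μ {y} ≤ a := le_iSup (fun y => μ {y}) y
  have hpre (i : Fin 3) (y) : sierf i ⁻¹' {y} = {(2 : ℝ) • y - vert i} := by
    ext u
    simp only [Set.mem_preimage, Set.mem_singleton_iff, sierf_apply, eq_sub_iff_add_eq]
    constructor
    · rintro rfl
      simp [smul_smul]
    · rintro h
      simp [h, smul_smul]
  have hbound (y) : μ {y} ≤ 3⁻¹ * (2 * a) := by
    rw [measure_eq_sum_sierf hinv (measurableSet_singleton y)]
    obtain ⟨i, hi⟩ := exists_half_lt_dist_vert y
    have hzero : μ (sierf i ⁻¹' {y}) = 0 := by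
      refine measure_mono_null (t := Sᶜ) (fun u hu huS => ?_) hsupp
      have hd := dist_sierf i u (vert i)
      rw [show sierf i u = y from hu, sierf_vert] at hd
      linarith [dist_vert_le_one_of_attractor hSc hSattr huS i]
    gcongr
    rw [← Finset.add_sum_erase _ _ (Finset.mem_univ i), hzero, zero_add]
    calc ∑ j ∈ Finset.univ.erase i, μ (sierf j ⁻¹' {y})
        ≤ (Finset.univ.erase i).card • a :=
          Finset.sum_le_card_nsmul _ _ _ fun j _ => (hpre j y).symm ▸ hatom _
      _ = 2 * a := by simp
  have hfin : a ≠ ∞ := ((iSup_le fun y => prob_le_one).trans_lt ENNReal.one_lt_top).ne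
  have hle : a ≤ 3⁻¹ * (2 * a) := iSup_le hbound
  have hreal := ENNReal.toReal_mono (by finiteness) hle
  simp only [ENNReal.toReal_mul, ENNReal.toReal_inv, ENNReal.toReal_ofNat] at hreal
  have hnn : 0 ≤ a.toReal := ENNReal.toReal_nonneg
  have ha0 : a = 0 := by
    refine (ENNReal.toReal_eq_zero_iff a).1 (by linarith) |>.resolve_right hfin
  exact ⟨fun y => le_antisymm (ha0 ▸ hatom y) zero_le⟩

theorem subsingleton_closedBall_inter_closedBall {E : Type*} [NormedAddCommGroup E]
    [NormedSpace ℝ E] [StrictConvexSpace ℝ E] {x z : E} {d r : ℝ} (hd : 0 < d) (hr : 0 ≤ r)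
    (h : d + r ≤ dist x z) : (Metric.closedBall x d ∩ Metric.closedBall z r).Subsingleton := by
  have hline : ∀ y ∈ Metric.closedBall x d ∩ Metric.closedBall z r,
      y = AffineMap.lineMap x z (d / (d + r)) := by
    rintro y ⟨hyx, hyz⟩
    rw [Metric.mem_closedBall'] at hyx
    rw [Metric.mem_closedBall] at hyz
    have htri := dist_triangle x y z
    have hxz : dist x z = d + r := by linarith
    have hpos : d + r ≠ 0 := by positivity
    apply eq_lineMap_of_dist_eq_mul_of_dist_eq_mul
    · rw [hxz, div_mul_cancel₀ _ hpos]
      linarith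
    · rw [hxz, sub_mul, div_mul_cancel₀ _ hpos]
      linarith
  exact fun u hu v hv => (hline u hu).trans (hline v hv).symm

/-- for the Sierpinski gasket, every `k ≥ 1`, every `x` and every `d` with
`2⁻ᵏ < d ≤ max_i ‖z_i − x‖`:
`μ_k(B(x, d − 2⁻ᵏ)) ≤ μ(B(x, d)) ≤ μ_k(B̊(x, d + 2⁻ᵏ))`. -/
theorem stmt18
    (S : Set (EuclideanSpace ℝ (Fin 2))) (hSc : IsCompact S) (hSne : S.Nonempty)
    (hSattr : S = ⋃ i, sierf i '' S)
    (μ : Measure (EuclideanSpace ℝ (Fin 2))) (hprob : IsProbabilityMeasure μ)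
    (hsupp : μ Sᶜ = 0)
    (hinv : μ = (3 : ℝ≥0∞)⁻¹ • (μ.map (sierf 0) + μ.map (sierf 1) + μ.map (sierf 2)))
    (k : ℕ) (hk : 1 ≤ k) (x : EuclideanSpace ℝ (Fin 2)) (d : ℝ)
    (hd1 : ((2 : ℝ) ^ k)⁻¹ < d)
    (hd2 : d ≤ max (dist (vert 0) x) (max (dist (vert 1) x) (dist (vert 2) x))) :
    muK k (Metric.closedBall x (d - ((2 : ℝ) ^ k)⁻¹)) ≤ μ (Metric.closedBall x d) ∧
    μ (Metric.closedBall x d) ≤ muK k (Metric.ball x (d + ((2 : ℝ) ^ k)⁻¹)) := by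
  obtain ⟨n, rfl⟩ : ∃ n, k = n + 1 := ⟨k - 1, by omega⟩
  set r : ℝ := ((2 : ℝ) ^ (n + 1))⁻¹
  have hr0 : 0 < r := by positivity
  have hatoms := nullSingletonClass_of_attractor hinv hSc hSattr hsupp
  have hball : MeasurableSet (Metric.closedBall x d) := Metric.isClosed_closedBall.measurableSet
  have hμ : μ (Metric.closedBall x d) = ((3 : ℝ≥0∞) ^ (n + 1))⁻¹ *
      ∑ w : Fin n → Fin 3, ∑ j,
        μ (wordMap sierf (List.ofFn w) ∘ sierf j ⁻¹' Metric.closedBall x d) := by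
    rw [measure_eq_sum_wordMap hinv n hball, pow_succ,
      ENNReal.mul_inv (Or.inl (by norm_num)) (Or.inl (by norm_num)), mul_assoc]
    congr 1
    rw [Finset.mul_sum]
    refine Finset.sum_congr rfl fun w _ => ?_
    rw [measure_eq_sum_sierf hinv ((continuous_wordMap_sierf _).measurable hball)]
    rfl
  have hmuK (A : Set (EuclideanSpace ℝ (Fin 2))) : muK (n + 1) A = ((3 : ℝ≥0∞) ^ (n + 1))⁻¹ *
      ∑ w : Fin n → Fin 3, ∑ j,
        Measure.dirac (wordMap sierf (List.ofFn w) (vert j)) A := by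
    simp [muK]
  have hcell (w : Fin n → Fin 3) (j : Fin 3) {y} (hy : y ∈ S) :
      dist (wordMap sierf (List.ofFn w) (sierf j y)) (wordMap sierf (List.ofFn w) (vert j)) ≤ r := by
    conv_lhs => rw [← sierf_vert j, dist_wordMap_sierf, dist_sierf, List.length_ofFn, ← mul_assoc,
      ← mul_inv, ← pow_succ]
    exact mul_le_of_le_one_right hr0.le (dist_vert_le_one_of_attractor hSc hSattr hy j)
  rw [hμ, hmuK, hmuK]
  constructor
  · refine mul_le_mul_right (Finset.sum_le_sum fun w _ => Finset.sum_le_sum fun j _ => ?_) _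
    by_cases hz : wordMap sierf (List.ofFn w) (vert j) ∈ Metric.closedBall x (d - r)
    · refine prob_le_one.trans (((prob_compl_eq_zero_iff hSc.measurableSet).1 hsupp).ge.trans
        (measure_mono fun y hy => ?_))
      rw [Metric.mem_closedBall] at hz
      have htri := dist_triangle (wordMap sierf (List.ofFn w) (sierf j y))
        (wordMap sierf (List.ofFn w) (vert j)) x
      change dist (wordMap sierf (List.ofFn w) (sierf j y)) x ≤ d
      linarith [hcell w j hy]
    · rw [Measure.dirac_apply' _ Metric.isClosed_closedBall.measurableSet,
        Set.indicator_of_notMem hz]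
      exact zero_le
  · refine mul_le_mul_right (Finset.sum_le_sum fun w _ => Finset.sum_le_sum fun j _ => ?_) _
    by_cases hz : wordMap sierf (List.ofFn w) (vert j) ∈ Metric.ball x (d + r)
    · rw [Measure.dirac_apply_of_mem hz]
      exact prob_le_one
    · have hsub := subsingleton_closedBall_inter_closedBall (hr0.trans hd1) hr0.le
        (not_lt.1 fun h => hz (Metric.mem_ball'.2 h))
      have hinj : Function.Injective (wordMap sierf (List.ofFn w) ∘ sierf j) := by
        intro u v huv
        have h0 := dist_eq_zero.2 huv
        simpa [dist_wordMap_sierf, dist_sierf] using h0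
      refine (le_of_eq ?_).trans zero_le
      rw [← measure_inter_conull hsupp]
      refine Set.Subsingleton.measure_zero (fun u hu v hv => hinj (hsub ?_ ?_)) μ
      · exact ⟨hu.1, hcell w j hu.2⟩
      · exact ⟨hv.1, hcell w j hv.2⟩
end
end
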